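/- Let H be a separable Hilbert space and let X be a centered Gaussian random vector in H with infinite-dimensional Cameron–Martin space, whose ordered nonzero covariance eigenvalues satisfy λ_j ~ φ(j) as j → ∞ for a decreasing function φ regularly varying at infinity of index −b with b > 1. Let U_X be the closed unit ball of the Cameron–Martin space. Then the quantization errors and entropy numbers are related by e_n(X) ~ (2 log n/(b−1))^{1/2} · e_n(U_X) as n → ∞. -/

import Mathlib

open MeasureTheory ProbabilityTheory Filter Real
open scoped RealInnerProductSpace NNReal

/-- The minimal `n`-th `L²`-quantization error of an `H`-valued random vector `X`. -/
noncomputable def quantErr {H : Type*} [NormedAddCommGroup H] [InnerProductSpace ℝ H]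
    {Ω : Type*} [MeasurableSpace Ω] (P : Measure Ω) (X : Ω → H) (n : ℕ) : ℝ :=
  sInf { r : ℝ | ∃ α : Finset H, α.Nonempty ∧ α.card ≤ n ∧
    r = (∫ ω, sInf ((fun a => ‖X ω - a‖ ^ 2) '' (α : Set H)) ∂P) ^ (1/2 : ℝ) }

/-- The `n`-th (Kolmogorov) entropy number of a subset `K` of `H`. -/
noncomputable def entropyNum {H : Type*} [NormedAddCommGroup H] (K : Set H) (n : ℕ) : ℝ :=
  sInf { r : ℝ | ∃ α : Finset H, α.Nonempty ∧ α.card ≤ n ∧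
    r = sSup ((fun x => sInf ((fun a => ‖x - a‖) '' (α : Set H))) '' K) }

theorem gaussianPDFReal_mul_exp_quadratic (μ c : ℝ) {v q : ℝ≥0} (hv : v ≠ 0) (hq : q ≠ 0) (x : ℝ) :
    gaussianPDFReal μ v x * rexp ((x - μ) ^ 2 / (2 * v) - (x - c) ^ 2 / (2 * q)) =
      √(q / v) * gaussianPDFReal c q x := by
  have hv' : (0 : ℝ) < v := by positivity
  have hq' : (0 : ℝ) < q := by positivity
  simp only [gaussianPDFReal]
  rw [mul_assoc, ← Real.exp_add, ← mul_assoc]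
  congr 1
  · rw [Real.sqrt_div hq'.le, Real.sqrt_mul (x := 2 * π) (by positivity) v,
      Real.sqrt_mul (x := 2 * π) (by positivity) q]
    field_simp
  · congr 1
    ring

theorem gaussianReal_withDensity_exp_quadratic (μ c : ℝ) {v q : ℝ≥0} (hv : v ≠ 0) (hq : q ≠ 0) :
    (gaussianReal μ v).withDensity
        (fun x => ENNReal.ofReal (rexp ((x - μ) ^ 2 / (2 * v) - (x - c) ^ 2 / (2 * q)))) =
      ENNReal.ofReal √(q / v) • gaussianReal c q := by
  rw [gaussianReal_of_var_ne_zero _ hv, gaussianReal_of_var_ne_zero _ hq,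
    ← withDensity_mul _ (by fun_prop) (by fun_prop), ← withDensity_smul _ (by fun_prop)]
  congr 1
  ext x
  simp only [Pi.mul_apply, Pi.smul_apply, smul_eq_mul, gaussianPDF]
  rw [← ENNReal.ofReal_mul (gaussianPDFReal_nonneg _ _ _),
    gaussianPDFReal_mul_exp_quadratic μ c hv hq, ENNReal.ofReal_mul (by positivity)]

theorem lintegral_exp_quadratic_gaussianReal (μ c : ℝ) {v q : ℝ≥0} (hv : v ≠ 0) (hq : q ≠ 0) :
    ∫⁻ x, ENNReal.ofReal (rexp ((x - μ) ^ 2 / (2 * v) - (x - c) ^ 2 / (2 * q)))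
      ∂(gaussianReal μ v) = ENNReal.ofReal √(q / v) := by
  have h := congrArg (fun ν => ν Set.univ) (gaussianReal_withDensity_exp_quadratic μ c hv hq)
  simpa using h

/-- Moment generating function of the square of a Gaussian variable with a linear term. -/
theorem lintegral_exp_mul_sq_gaussianReal (e : ℝ) {q : ℝ≥0} (hq : q ≠ 0) (t : ℝ)
    (ht : 2 * t * q < 1) :
    ∫⁻ x, ENNReal.ofReal (rexp (t * x ^ 2)) ∂(gaussianReal e q) =
      ENNReal.ofReal (√(1 / (1 - 2 * t * q)) * rexp (t * e ^ 2 / (1 - 2 * t * q))) := by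
  have hd : 0 < 1 - 2 * t * q := by linarith
  have hq0 : (0 : ℝ) < q := by positivity
  set q' : ℝ≥0 := (q / (1 - 2 * t * q) : ℝ).toNNReal with hq'
  have hq'c : (q' : ℝ) = q / (1 - 2 * t * q) := Real.coe_toNNReal _ (by positivity)
  have hq'0 : q' ≠ 0 := by
    intro h
    have : (q' : ℝ) = 0 := by simp [h]
    rw [hq'c] at this
    exact absurd this (by positivity)
  have h := lintegral_exp_quadratic_gaussianReal e (e / (1 - 2 * t * q)) hq hq'0
  have h1 : ∀ x : ℝ, ENNReal.ofReal (rexp (t * x ^ 2)) =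
      ENNReal.ofReal (rexp (t * e ^ 2 / (1 - 2 * t * q))) *
      ENNReal.ofReal (rexp ((x - e) ^ 2 / (2 * q) -
        (x - e / (1 - 2 * t * q)) ^ 2 / (2 * q'))) := by
    intro x
    rw [← ENNReal.ofReal_mul (by positivity), ← Real.exp_add, hq'c]
    congr 2
    have hd' := hd.ne'
    generalize hD : 1 - 2 * t * (q : ℝ) = D at *
    have ht' : t = (1 - D) / (2 * q) := by rw [← hD]; field_simp; ring
    rw [ht']
    field_simp
    ring
  simp_rw [h1]
  rw [lintegral_const_mul _ (by fun_prop), h, mul_comm (√_),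
    ENNReal.ofReal_mul (by positivity), hq'c]
  congr 3
  field_simp

theorem lintegral_exp_mul_sq_gaussianReal_le (e : ℝ) {q : ℝ≥0} (hq : q ≠ 0) {t : ℝ} (ht0 : 0 ≤ t)
    {Q : ℝ} (hqQ : (q : ℝ) ≤ Q) (ht : t * Q ≤ 1 / 4) :
    ∫⁻ x, ENNReal.ofReal (rexp (t * x ^ 2)) ∂(gaussianReal e q) ≤
      ENNReal.ofReal (rexp (t * (1 + 4 * t * Q) * (e ^ 2 + q))) := by
  have hq0 : (0 : ℝ) < q := by positivity
  have htq : t * q ≤ t * Q := by gcongr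
  have h0 : 0 ≤ t * q := by positivity
  rw [lintegral_exp_mul_sq_gaussianReal e hq t (by nlinarith)]
  apply ENNReal.ofReal_le_ofReal
  set w : ℝ := 2 * (t * q) with hw
  have hw1 : 1 - 2 * t * q = 1 - w := by rw [hw]; ring
  rw [hw1]
  have hw2 : w ≤ 1 / 2 := by linarith
  have hw0 : 0 ≤ w := by positivity
  have hinv : 1 / (1 - w) ≤ 1 + 2 * w := by
    rw [div_le_iff₀ (by linarith)]; nlinarith
  have hexp : 1 / (1 - w) ≤ rexp (w + w ^ 2) := by
    have h1 : 1 / (1 - w) ≤ 1 + (w + w ^ 2) + (w + w ^ 2) ^ 2 / 2 := by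
      rw [div_le_iff₀ (by linarith)]
      nlinarith [pow_nonneg hw0 2, pow_nonneg hw0 3, pow_nonneg hw0 4, mul_nonneg hw0 (sub_nonneg.2 hw2), mul_nonneg (pow_nonneg hw0 2) (sub_nonneg.2 hw2), mul_nonneg (pow_nonneg hw0 3) (sub_nonneg.2 hw2), mul_nonneg (pow_nonneg hw0 4) (sub_nonneg.2 hw2)]
    exact h1.trans (Real.quadratic_le_exp_of_nonneg (by positivity))
  have hs : √(1 / (1 - w)) ≤ rexp ((w + w ^ 2) / 2) := by
    rw [Real.exp_half]; exact Real.sqrt_le_sqrt hexp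
  calc √(1 / (1 - w)) * rexp (t * e ^ 2 / (1 - w))
      ≤ rexp ((w + w ^ 2) / 2) * rexp (t * e ^ 2 * (1 + 2 * w)) := by
        gcongr
        rw [div_eq_mul_one_div]
        gcongr
    _ = rexp ((w + w ^ 2) / 2 + t * e ^ 2 * (1 + 2 * w)) := (Real.exp_add _ _).symm
    _ ≤ _ := by
        apply Real.exp_le_exp.2
        have ha : (w + w ^ 2) / 2 ≤ t * (1 + 4 * t * Q) * q := by
          rw [hw]; nlinarith [mul_nonneg h0 (sub_nonneg.2 htq)]
        have hb : t * e ^ 2 * (1 + 2 * w) ≤ t * e ^ 2 * (1 + 4 * t * Q) := by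
          have : 2 * w ≤ 4 * t * Q := by linarith
          gcongr
        nlinarith

theorem lintegral_pi_prod {ι : Type*} [Fintype ι] (ν : ι → Measure ℝ)
    [∀ i, IsProbabilityMeasure (ν i)] (f : ι → ℝ → ENNReal) (hf : ∀ i, Measurable (f i)) :
    ∫⁻ x, ∏ i, f i (x i) ∂(Measure.pi ν) = ∏ i, ∫⁻ x, f i x ∂(ν i) := by
  rw [lintegral_prod_eq_prod_lintegral_of_indepFun Finset.univ (fun i (x : ι → ℝ) => f i (x i))
    (iIndepFun_pi (μ := ν) (X := f) fun i => (hf i).aemeasurable) (fun i => by fun_prop)]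
  refine Finset.prod_congr rfl fun i _ => ?_
  exact (measurePreserving_eval ν i).lintegral_comp (hf i)

theorem pi_withDensity {ι : Type*} [Fintype ι] (ν : ι → Measure ℝ)
    [∀ i, IsProbabilityMeasure (ν i)] (f : ι → ℝ → ENNReal) (hf : ∀ i, Measurable (f i))
    [∀ i, SigmaFinite ((ν i).withDensity (f i))] :
    Measure.pi (fun i => (ν i).withDensity (f i)) =
      (Measure.pi ν).withDensity (fun x => ∏ i, f i (x i)) := by
  refine Measure.pi_eq fun s hs => ?_
  rw [withDensity_apply _ (.univ_pi hs), ← lintegral_indicator (.univ_pi hs)]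
  simp_rw [withDensity_apply _ (hs _), ← lintegral_indicator (hs _)]
  rw [← lintegral_pi_prod ν _ fun i => (hf i).indicator (hs i)]
  congr 1 with x
  by_cases hx : x ∈ Set.univ.pi s
  · rw [Set.indicator_of_mem hx]
    exact Finset.prod_congr rfl fun i _ => by rw [Set.indicator_of_mem (hx i trivial)]
  · rw [Set.indicator_of_notMem hx]
    simp only [Set.mem_univ_pi, not_forall] at hx
    obtain ⟨i, hi⟩ := hx
    exact (Finset.prod_eq_zero (Finset.mem_univ i) (Set.indicator_of_notMem hi _)).symm

theorem integral_sq_gaussianReal (c : ℝ) (q : ℝ≥0) :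
    Integrable (fun x => x ^ 2) (gaussianReal c q) ∧
      ∫ x, x ^ 2 ∂(gaussianReal c q) = q + c ^ 2 := by
  have h2 : MemLp (fun x : ℝ => x) 2 (gaussianReal c q) := memLp_id_gaussianReal' 2 (by simp)
  refine ⟨h2.integrable_sq, ?_⟩
  have h := variance_eq_sub h2
  rw [variance_fun_id_gaussianReal, integral_id_gaussianReal] at h
  simp only [Pi.pow_apply] at h
  linarith

theorem integral_sub_sq_gaussianReal (c : ℝ) (q : ℝ≥0) :
    Integrable (fun x => (x - c) ^ 2) (gaussianReal c q) ∧
      ∫ x, (x - c) ^ 2 ∂(gaussianReal c q) = q := by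
  have h2 : MemLp (fun x : ℝ => x) 2 (gaussianReal c q) := memLp_id_gaussianReal' 2 (by simp)
  refine ⟨(h2.sub (memLp_const c)).integrable_sq, ?_⟩
  have h := variance_eq_integral (μ := gaussianReal c q) (X := fun x : ℝ => x) (by fun_prop)
  rw [variance_fun_id_gaussianReal, integral_id_gaussianReal] at h
  exact h.symm

theorem lintegral_exp_mul_sum_sub_sq_gaussian_le {ι : Type*} [Fintype ι] (c x : ι → ℝ)
    (q : ι → ℝ≥0) (hq : ∀ i, q i ≠ 0) {t Q : ℝ} (ht0 : 0 ≤ t) (hqQ : ∀ i, (q i : ℝ) ≤ Q)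
    (ht : t * Q ≤ 1 / 4) :
    ∫⁻ y, ENNReal.ofReal (rexp (t * ∑ i, (y i - x i) ^ 2))
        ∂(Measure.pi fun i => gaussianReal (c i) (q i)) ≤
      ENNReal.ofReal (rexp (t * (1 + 4 * t * Q) * ∑ i, ((c i - x i) ^ 2 + q i))) := by
  simp_rw [Finset.mul_sum, Real.exp_sum, ENNReal.ofReal_prod_of_nonneg
    (fun i _ => (Real.exp_pos _).le)]
  rw [lintegral_pi_prod _ (fun i y => ENNReal.ofReal (rexp (t * (y - x i) ^ 2)))
    (fun i => by fun_prop)]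
  refine Finset.prod_le_prod' fun i _ => ?_
  have h := lintegral_exp_mul_sq_gaussianReal_le (c i - x i) (hq i) ht0 (hqQ i) ht
  rwa [← gaussianReal_map_sub_const, lintegral_map (by fun_prop) (by fun_prop)] at h

/-- The log-likelihood ratio of the product of the Gaussian laws `N(c i, q i)` with respect to the
product of the centered Gaussian laws `N(0, σ i)`. -/
noncomputable def gaussianLLR {ι : Type*} [Fintype ι] (c : ι → ℝ) (q σ : ι → ℝ≥0)
    (y : ι → ℝ) : ℝ :=
  ∑ i, (Real.log (σ i / q i) / 2 + y i ^ 2 / (2 * σ i) - (y i - c i) ^ 2 / (2 * q i))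

theorem gaussianReal_eq_withDensity (c : ℝ) {σ q : ℝ≥0} (hσ : σ ≠ 0) (hq : q ≠ 0) :
    gaussianReal 0 σ = (gaussianReal c q).withDensity (fun x => ENNReal.ofReal
      (rexp (-(Real.log (σ / q) / 2 + x ^ 2 / (2 * σ) - (x - c) ^ 2 / (2 * q))))) := by
  have hσ' : (0 : ℝ) < σ := by positivity
  have hq' : (0 : ℝ) < q := by positivity
  have h := gaussianReal_withDensity_exp_quadratic c 0 hq hσ
  have hs : rexp (-(Real.log (σ / q) / 2)) * √(σ / q) = 1 := by
    rw [Real.sqrt_eq_rpow, Real.rpow_def_of_pos (by positivity), ← Real.exp_add]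
    simp [div_eq_mul_inv]
  have hf : (fun x : ℝ => ENNReal.ofReal
      (rexp (-(Real.log (σ / q) / 2 + x ^ 2 / (2 * σ) - (x - c) ^ 2 / (2 * q))))) =
      ENNReal.ofReal (rexp (-(Real.log (σ / q) / 2))) • (fun x : ℝ => ENNReal.ofReal
        (rexp ((x - c) ^ 2 / (2 * q) - (x - 0) ^ 2 / (2 * σ)))) := by
    ext x
    simp only [Pi.smul_apply, smul_eq_mul]
    rw [← ENNReal.ofReal_mul (by positivity), ← Real.exp_add]
    congr 2
    ring
  rw [hf, withDensity_smul _ (by fun_prop), h, smul_smul, ← ENNReal.ofReal_mul (by positivity), hs]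
  simp

theorem pi_gaussianReal_eq_withDensity {ι : Type*} [Fintype ι] (c : ι → ℝ) {q σ : ι → ℝ≥0}
    (hq : ∀ i, q i ≠ 0) (hσ : ∀ i, σ i ≠ 0) :
    Measure.pi (fun i => gaussianReal 0 (σ i)) =
      (Measure.pi fun i => gaussianReal (c i) (q i)).withDensity
        (fun y => ENNReal.ofReal (rexp (-gaussianLLR c q σ y))) := by
  have h1 : ∀ i, gaussianReal 0 (σ i) = _ := fun i => gaussianReal_eq_withDensity (c i) (hσ i) (hq i)
  have : ∀ i, SigmaFinite ((gaussianReal (c i) (q i)).withDensity (fun x => ENNReal.ofReal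
      (rexp (-(Real.log (σ i / q i) / 2 + x ^ 2 / (2 * σ i) - (x - c i) ^ 2 / (2 * q i)))))) :=
    fun i => by rw [← h1]; infer_instance
  rw [show (fun i => gaussianReal 0 (σ i)) = _ from funext h1, pi_withDensity _ _ fun i => by fun_prop]
  congr 1
  ext y
  rw [gaussianLLR, ← Finset.sum_neg_distrib, Real.exp_sum, ENNReal.ofReal_prod_of_nonneg
    (fun i _ => (Real.exp_pos _).le)]

theorem integral_gaussianLLR {ι : Type*} [Fintype ι] (c : ι → ℝ) {q σ : ι → ℝ≥0}
    (hq : ∀ i, q i ≠ 0) :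
    Integrable (gaussianLLR c q σ) (Measure.pi fun i => gaussianReal (c i) (q i)) ∧
    ∫ y, gaussianLLR c q σ y ∂(Measure.pi fun i => gaussianReal (c i) (q i)) =
      ∑ i, (Real.log (σ i / q i) + (q i + c i ^ 2) / σ i - 1) / 2 := by
  have hmp : ∀ i, MeasurePreserving (Function.eval i)
      (Measure.pi fun i => gaussianReal (c i) (q i)) (gaussianReal (c i) (q i)) :=
    fun i => measurePreserving_eval (fun i => gaussianReal (c i) (q i)) i
  have h1 : ∀ i, Integrable (fun x : ℝ => Real.log (σ i / q i) / 2 + x ^ 2 / (2 * σ i)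
      - (x - c i) ^ 2 / (2 * q i)) (gaussianReal (c i) (q i)) := fun i =>
    ((integrable_const _).add ((integral_sq_gaussianReal _ _).1.div_const _)).sub
      ((integral_sub_sq_gaussianReal _ _).1.div_const _)
  have h2 : ∀ i, Integrable (fun y : ι → ℝ => Real.log (σ i / q i) / 2 + y i ^ 2 / (2 * σ i)
      - (y i - c i) ^ 2 / (2 * q i)) (Measure.pi fun i => gaussianReal (c i) (q i)) :=
    fun i => (hmp i).integrable_comp_of_integrable (h1 i)
  refine ⟨integrable_finsetSum _ fun i _ => h2 i, ?_⟩
  simp only [gaussianLLR]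
  rw [integral_finsetSum _ fun i _ => h2 i]
  refine Finset.sum_congr rfl fun i _ => ?_
  have h3 : ∫ y : ι → ℝ, (Real.log (σ i / q i) / 2 + y i ^ 2 / (2 * σ i)
      - (y i - c i) ^ 2 / (2 * q i)) ∂(Measure.pi fun i => gaussianReal (c i) (q i)) =
      ∫ x : ℝ, (Real.log (σ i / q i) / 2 + x ^ 2 / (2 * σ i)
      - (x - c i) ^ 2 / (2 * q i)) ∂(gaussianReal (c i) (q i)) := by
    conv_rhs => rw [← (hmp i).map_eq]
    rw [integral_map (hmp i).aemeasurable (by fun_prop)]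
  have hq' : (q i : ℝ) ≠ 0 := by simpa using hq i
  have hA : Integrable (fun x : ℝ => Real.log (σ i / q i) / 2 + x ^ 2 / (2 * σ i))
      (gaussianReal (c i) (q i)) :=
    (integrable_const _).add ((integral_sq_gaussianReal _ _).1.div_const _)
  rw [h3, integral_sub hA ((integral_sub_sq_gaussianReal _ _).1.div_const _),
    integral_add (integrable_const _) ((integral_sq_gaussianReal _ _).1.div_const _),
    integral_div, integral_div, integral_div, (integral_sq_gaussianReal _ _).2,
    (integral_sub_sq_gaussianReal _ _).2]
  simp
  field_simp

/-- A lower bound for the probability of an event from the relative entropy of a second law. -/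
theorem exp_neg_le_measureReal_of_withDensity {E : Type*} [MeasurableSpace E] {P Q : Measure E}
    [IsProbabilityMeasure P] [IsProbabilityMeasure Q] {l : E → ℝ} (hl : Measurable l)
    (hPQ : P = Q.withDensity (fun y => ENNReal.ofReal (rexp (-l y)))) (hli : Integrable l Q)
    {B : Set E} (hB : MeasurableSet B) {κ ε : ℝ} (hκ0 : 0 ≤ κ) (hε : 0 ≤ ε) (hκ : ∫ y, l y ∂Q ≤ κ)
    (hQB : 1 / (1 + ε) ≤ Q.real B) :
    rexp (-((1 + ε) * (κ + Real.log 2))) ≤ P.real B := by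
  by_contra! hlt
  set T := (1 + ε) * (κ + Real.log 2) with hT
  have hlog2 : 0 < Real.log 2 := Real.log_pos (by norm_num)
  have hT0 : 0 < T := by positivity
  set g : E → ℝ := fun y => B.indicator (fun _ => T) y - l y with hg
  have hgm : Measurable g := (measurable_const.indicator hB).sub hl
  have hgi : Integrable g Q := ((integrable_const T).indicator hB).sub hli
  have hexp : ∀ y, rexp (g y) = rexp (B.indicator (fun _ => T) y) * rexp (-l y) := fun y => by
    rw [← Real.exp_add]; rfl
  have hbd : ∀ y, rexp (B.indicator (fun _ => T) y) ≤ 1 + B.indicator (fun _ => rexp T) y := by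
    intro y
    by_cases hy : y ∈ B
    · simp [hy]
    · simp [hy]
  have hlint : ∫⁻ y, ENNReal.ofReal (rexp (g y)) ∂Q ≤ ENNReal.ofReal (1 + rexp T * P.real B) := by
    calc ∫⁻ y, ENNReal.ofReal (rexp (g y)) ∂Q
        = ∫⁻ y, ENNReal.ofReal (rexp (B.indicator (fun _ => T) y)) ∂P := by
          rw [hPQ, lintegral_withDensity_eq_lintegral_mul _ (by fun_prop)
            ((measurable_const.indicator hB).exp.ennreal_ofReal)]
          refine lintegral_congr fun y => ?_
          rw [hexp, mul_comm, ENNReal.ofReal_mul (by positivity)]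
          rfl
      _ ≤ ∫⁻ y, ENNReal.ofReal (1 + B.indicator (fun _ => rexp T) y) ∂P :=
          lintegral_mono fun y => ENNReal.ofReal_le_ofReal (hbd y)
      _ = ENNReal.ofReal (∫ y, (1 + B.indicator (fun _ => rexp T) y) ∂P) := by
          rw [ofReal_integral_eq_lintegral_ofReal]
          · exact (integrable_const _).add ((integrable_const _).indicator hB)
          · exact Eventually.of_forall fun y => add_nonneg zero_le_one
              (Set.indicator_nonneg (fun _ _ => (Real.exp_pos _).le) _)
      _ = _ := by
          rw [integral_add (integrable_const _) ((integrable_const _).indicator hB),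
            integral_indicator_const _ hB]
          simp [mul_comm]
  have hgexp : Integrable (fun y => rexp (g y)) Q := by
    refine ⟨hgm.exp.aestronglyMeasurable, ?_⟩
    rw [hasFiniteIntegral_iff_ofReal (Eventually.of_forall fun y => (Real.exp_pos _).le)]
    exact hlint.trans_lt ENNReal.ofReal_lt_top
  have hJ : rexp (∫ y, g y ∂Q) ≤ ∫ y, rexp (g y) ∂Q :=
    convexOn_exp.map_integral_le continuous_exp.continuousOn isClosed_univ
      (Eventually.of_forall fun _ => trivial) hgi hgexp
  have hI : ∫ y, rexp (g y) ∂Q ≤ 1 + rexp T * P.real B := by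
    rw [integral_eq_lintegral_of_nonneg_ae (Eventually.of_forall fun y => (Real.exp_pos _).le)
      hgexp.1]
    exact ENNReal.toReal_le_of_le_ofReal (by positivity) hlint
  have h2 : 1 + rexp T * P.real B < 2 := by
    have : rexp T * P.real B < rexp T * rexp (-T) := by gcongr
    rw [← Real.exp_add] at this
    simp at this
    linarith
  have hgint : ∫ y, g y ∂Q = Q.real B * T - ∫ y, l y ∂Q := by
    rw [hg, integral_sub ((integrable_const T).indicator hB) hli, integral_indicator_const _ hB]
    simp
  have h3 : rexp (∫ y, g y ∂Q) < 2 := by linarith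
  have h4 : ∫ y, g y ∂Q < Real.log 2 := (Real.lt_log_iff_exp_lt (by norm_num)).2 h3
  have h5 : κ + Real.log 2 ≤ Q.real B * T := by
    calc κ + Real.log 2 = 1 / (1 + ε) * T := by rw [hT]; field_simp
      _ ≤ _ := by gcongr
  linarith

/-- Greedy covering: if every set `B x` has measure at least `p` under a measure of total mass at
most `T`, then a finite set of points `x` can be hit with few points. -/
theorem exists_card_le_forall_mem_of_measure_ge {E F : Type*} [MeasurableSpace E] [DecidableEq E]
    (μ : Measure E) [IsFiniteMeasure μ] {T p : ℝ} (hT : μ.real Set.univ ≤ T) (hp : 0 < p)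
    (B : F → Set E) (hB : ∀ x, MeasurableSet (B x)) (k : ℕ) :
    ∀ S : Finset F, (∀ x ∈ S, p ≤ μ.real (B x)) → (S.card : ℝ) * (1 - p / T) ^ k < 1 →
      ∃ A : Finset E, A.card ≤ k ∧ ∀ x ∈ S, ∃ a ∈ A, a ∈ B x := by
  classical
  induction k with
  | zero =>
    intro S _ hS
    have : S = ∅ := by
      simp at hS
      exact hS
    exact ⟨∅, by simp, by simp [this]⟩
  | succ k ih =>
    intro S hS hc
    by_cases hSe : S = ∅
    · exact ⟨∅, by simp, by simp [hSe]⟩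
    obtain ⟨x₀, hx₀⟩ := Finset.nonempty_iff_ne_empty.2 hSe
    have hTp : p ≤ T := (hS x₀ hx₀).trans ((measureReal_mono (Set.subset_univ _)).trans hT)
    have hT0 : 0 < T := hp.trans_le hTp
    have hint : ∫ y, ∑ x ∈ S, (B x).indicator (fun _ => (1 : ℝ)) y ∂μ ≥ S.card * p := by
      rw [integral_finsetSum _ fun x _ => (integrable_const _).indicator (hB x)]
      calc (S.card : ℝ) * p = ∑ x ∈ S, p := by simp
        _ ≤ _ := Finset.sum_le_sum fun x hx => by
          rw [integral_indicator_const _ (hB x)]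
          simpa using hS x hx
    obtain ⟨y, hy⟩ : ∃ y, S.card * p / T ≤ ∑ x ∈ S, (B x).indicator (fun _ => (1 : ℝ)) y := by
      have hμ0 : 0 < μ.real Set.univ :=
        hp.trans_le ((hS x₀ hx₀).trans (measureReal_mono (Set.subset_univ _)))
      have hμ : μ ≠ 0 := by
        rintro rfl
        simp at hμ0
      obtain ⟨y, hy⟩ := exists_average_le hμ
        (integrable_finsetSum S fun x _ => (integrable_const (1 : ℝ)).indicator (hB x))
      refine ⟨y, le_trans ?_ hy⟩
      rw [average_eq, smul_eq_mul, ← div_eq_inv_mul]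
      have hint0 := le_trans (by positivity) hint
      gcongr
    have hcard : (S.filter fun x => y ∉ B x).card + (∑ x ∈ S, (B x).indicator (fun _ => (1 : ℝ)) y)
        = S.card := by
      have h1 : ∑ x ∈ S, (B x).indicator (fun _ => (1 : ℝ)) y =
          ((S.filter fun x => y ∈ B x).card : ℝ) := by
        simp [Set.indicator_apply, Finset.sum_boole]
      rw [h1, ← Finset.card_filter_add_card_filter_not (s := S) (fun x => y ∈ B x)]
      push_cast
      ring
    obtain ⟨A, hA, hAc⟩ := ih (S.filter fun x => y ∉ B x)
      (fun x hx => hS x (Finset.mem_of_mem_filter x hx)) (by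
        refine lt_of_le_of_lt ?_ hc
        rw [pow_succ', ← mul_assoc]
        have h0 : 0 ≤ 1 - p / T := by
          rw [sub_nonneg, div_le_one hT0]; exact hTp
        gcongr
        have : (S.card : ℝ) * (1 - p / T) = S.card - S.card * p / T := by ring
        rw [this]
        linarith)
    refine ⟨insert y A, (Finset.card_insert_le _ _).trans (by omega), fun x hx => ?_⟩
    by_cases hxy : y ∈ B x
    · exact ⟨y, Finset.mem_insert_self _ _, hxy⟩
    · obtain ⟨a, ha, hax⟩ := hAc x (Finset.mem_filter.2 ⟨hx, hxy⟩)
      exact ⟨a, Finset.mem_insert_of_mem ha, hax⟩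

theorem exists_card_le_log_forall_mem_of_measure_ge {E F : Type*} [MeasurableSpace E]
    [DecidableEq E]
    (μ : Measure E) [IsFiniteMeasure μ] {T p : ℝ} (hT : μ.real Set.univ ≤ T) (hp : 0 < p)
    (hpT : p ≤ T)
    (B : F → Set E) (hB : ∀ x, MeasurableSet (B x)) (S : Finset F)
    (hS : ∀ x ∈ S, p ≤ μ.real (B x)) {M : ℝ} (hM : (S.card : ℝ) ≤ rexp M) (hM0 : 0 ≤ M) :
    ∃ A : Finset E, (A.card : ℝ) ≤ T * M / p + 1 ∧ ∀ x ∈ S, ∃ a ∈ A, a ∈ B x := by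
  have hT0 : 0 < T := hp.trans_le hpT
  have hk : T * M / p < (⌊T * M / p⌋₊ + 1 : ℕ) := by exact_mod_cast Nat.lt_floor_add_one _
  obtain ⟨A, hA, hA'⟩ := exists_card_le_forall_mem_of_measure_ge μ hT hp B hB
    (⌊T * M / p⌋₊ + 1) S hS (by
      have h0 : 0 ≤ 1 - p / T := by
        rw [sub_nonneg, div_le_one hT0]; exact hpT
      calc (S.card : ℝ) * (1 - p / T) ^ (⌊T * M / p⌋₊ + 1)
          ≤ rexp M * (rexp (-(p / T))) ^ (⌊T * M / p⌋₊ + 1) := by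
            gcongr
            linarith [Real.add_one_le_exp (-(p / T))]
        _ = rexp (M - (⌊T * M / p⌋₊ + 1 : ℕ) * (p / T)) := by
            rw [← Real.exp_nat_mul, ← Real.exp_add]
            ring_nf
        _ < 1 := by
            rw [Real.exp_lt_one_iff]
            have : T * M / p * (p / T) < (⌊T * M / p⌋₊ + 1 : ℕ) * (p / T) := by
              gcongr
            have h2 : T * M / p * (p / T) = M := by field_simp
            linarith)
  refine ⟨A, ?_, hA'⟩
  calc (A.card : ℝ) ≤ (⌊T * M / p⌋₊ + 1 : ℕ) := by exact_mod_cast hA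
    _ ≤ _ := by
      push_cast
      gcongr
      exact Nat.floor_le (by positivity)

/-- Coordinate variances of the random codebook for points whose energy in the block `k` is at most
`w k`. -/
noncomputable def codeVar {ι κ : Type*} [Fintype ι] [DecidableEq κ] (blk : ι → κ) (Λ : κ → ℝ)
    (θ D : ℝ) (w : κ → ℝ) (i : ι) : ℝ≥0 :=
  (w (blk i) * (Λ (blk i) - θ) / ((Finset.univ.filter fun i' => blk i' = blk i).card + D)).toNNReal

theorem exp_neg_le_codebook_ball {ι κ : Type*} [Fintype ι] [Fintype κ] [DecidableEq κ]
    (blk : ι → κ) {lam : ι → ℝ} {Λ w : κ → ℝ} {θ D ε E₀ : ℝ} (hθ : 0 < θ) (hD : 0 < D)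
    (hε : 0 < ε) (hε1 : ε ≤ 1) (hΛ : ∀ k, θ < Λ k) (hlam : ∀ i, 0 < lam i)
    (hlamΛ : ∀ i, lam i ≤ Λ (blk i)) (hw : ∀ k, 0 < w k) (hw2 : ∀ k, w k ≤ 2)
    (hE₀ : E₀ ≤ 1) (hwE : ∑ k, w k ≤ E₀ + ε) (hDε : rexp (-(ε ^ 2 * D / 64)) ≤ ε / 2)
    (x : ι → ℝ) (hx : ∀ k, ∑ i with blk i = k, x i ^ 2 / lam i ≤ w k) :
    rexp (-((1 + ε) * (((∑ i, Real.log (Λ (blk i) / θ)) / 2 + Fintype.card κ * D / 2)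
        + Real.log 2))) ≤
      (Measure.pi fun i => gaussianReal 0 (codeVar blk Λ θ D w i)).real
        {y | ∑ i, (y i - x i) ^ 2 ≤ θ * (E₀ + 2 * ε)} := by
  set d : κ → ℝ := fun k => (Finset.univ.filter fun i' => blk i' = k).card with hd
  have hd0 : ∀ k, 0 ≤ d k := fun k => Nat.cast_nonneg _
  have hDk : ∀ k, 0 < d k + D := fun k => by linarith [hd0 k]
  have hΛ0 : ∀ k, 0 < Λ k := fun k => hθ.trans (hΛ k)
  set ρ : κ → ℝ := fun k => θ / Λ k with hρ
  have hρ0 : ∀ k, 0 < ρ k := fun k => div_pos hθ (hΛ0 k)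
  have hρ1 : ∀ k, ρ k < 1 := fun k => (div_lt_one (hΛ0 k)).2 (hΛ k)
  set σ := codeVar blk Λ θ D w with hσ
  have hσc : ∀ i, (σ i : ℝ) = w (blk i) * (Λ (blk i) - θ) / (d (blk i) + D) := fun i =>
    Real.coe_toNNReal _ (div_nonneg (mul_nonneg (hw _).le (sub_pos.2 (hΛ _)).le) (hDk _).le)
  have hσ0 : ∀ i, 0 < (σ i : ℝ) := fun i => by
    rw [hσc]
    exact div_pos (mul_pos (hw _) (sub_pos.2 (hΛ _))) (hDk _)
  set q : ι → ℝ≥0 := fun i => (σ i * ρ (blk i) : ℝ).toNNReal with hq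
  have hqc : ∀ i, (q i : ℝ) = σ i * ρ (blk i) := fun i =>
    Real.coe_toNNReal _ (mul_nonneg (hσ0 i).le (hρ0 _).le)
  have hq0 : ∀ i, 0 < (q i : ℝ) := fun i => by rw [hqc]; exact mul_pos (hσ0 i) (hρ0 _)
  have hqne : ∀ i, q i ≠ 0 := fun i h => by have := hq0 i; simp [h] at this
  have hσne : ∀ i, σ i ≠ 0 := fun i h => by have := hσ0 i; simp [h] at this
  have hqv : ∀ i, (q i : ℝ) = w (blk i) * θ * (1 - ρ (blk i)) / (d (blk i) + D) := fun i => by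
    have := (hΛ0 (blk i)).ne'
    have := (hDk (blk i)).ne'
    rw [hqc, hσc, hρ]
    field_simp
  set c : ι → ℝ := fun i => x i * (1 - ρ (blk i)) with hc
  have hblock : ∀ f : ι → ℝ, ∑ i, f i = ∑ k, ∑ i with blk i = k, f i := fun f =>
    (Finset.sum_fiberwise Finset.univ blk f).symm
  have hcard : ∀ k (r : ℝ), ∑ i with blk i = k, r = d k * r := fun k r => by
    rw [Finset.sum_const, nsmul_eq_mul]
  have hxΛ : ∀ i, x i ^ 2 / Λ (blk i) ≤ x i ^ 2 / lam i := fun i =>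
    div_le_div_of_nonneg_left (sq_nonneg _) (hlam i) (hlamΛ i)
  have hbx : ∀ k, ∑ i with blk i = k, x i ^ 2 / Λ (blk i) ≤ w k := fun k =>
    (Finset.sum_le_sum fun i _ => hxΛ i).trans (hx k)
  -- the relative entropy
  have hKL : ∫ y, gaussianLLR c q σ y ∂(Measure.pi fun i => gaussianReal (c i) (q i)) ≤
      (∑ i, Real.log (Λ (blk i) / θ)) / 2 + Fintype.card κ * D / 2 := by
    rw [(integral_gaussianLLR c hqne).2]
    have h1 : ∀ i, (Real.log (σ i / q i) + (q i + c i ^ 2) / σ i - 1) / 2 =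
        Real.log (Λ (blk i) / θ) / 2 + (x i ^ 2 / Λ (blk i) * ((1 - ρ (blk i)) *
          (d (blk i) + D) / w (blk i)) - (1 - ρ (blk i))) / 2 := fun i => by
      have h2 : (σ i : ℝ) / q i = Λ (blk i) / θ := by
        rw [hqc, hρ]; have := (hσ0 i).ne'; have := (hΛ0 (blk i)).ne'; field_simp
      have h3 : (q i : ℝ) / σ i = ρ (blk i) := by
        rw [hqc]; have := (hσ0 i).ne'; field_simp
      have h4 : c i ^ 2 / σ i = x i ^ 2 / Λ (blk i) * ((1 - ρ (blk i)) *
          (d (blk i) + D) / w (blk i)) := by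
        have e1 : Λ (blk i) - θ = Λ (blk i) * (1 - ρ (blk i)) := by
          rw [hρ]; have := (hΛ0 (blk i)).ne'; field_simp
        have e2 : 1 - ρ (blk i) ≠ 0 := by linarith [hρ1 (blk i)]
        rw [hσc, e1]
        have := (hΛ0 (blk i)).ne'; have := (hDk (blk i)).ne'; have := (hw (blk i)).ne'
        simp only [hc]
        field_simp
      rw [h2, add_div, h3, h4]
      ring
    rw [Finset.sum_congr rfl fun i _ => h1 i, Finset.sum_add_distrib, ← Finset.sum_div,
      ← Finset.sum_div, hblock (fun i => _ - _)]
    gcongr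
    calc _ ≤ ∑ k : κ, D := Finset.sum_le_sum fun k _ => by
            have h5 : ∑ i with blk i = k, (x i ^ 2 / Λ (blk i) * ((1 - ρ (blk i)) *
                (d (blk i) + D) / w (blk i)) - (1 - ρ (blk i))) =
                (∑ i with blk i = k, x i ^ 2 / Λ (blk i)) * ((1 - ρ k) * (d k + D) / w k)
                  - d k * (1 - ρ k) := by
              rw [Finset.sum_mul, ← hcard, ← Finset.sum_sub_distrib]
              refine Finset.sum_congr rfl fun i hi => ?_
              rw [(Finset.mem_filter.1 hi).2]
            have h6 : 0 < 1 - ρ k := by linarith [hρ1 k]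
            have h7 : 0 ≤ (1 - ρ k) * (d k + D) / w k :=
              div_nonneg (mul_nonneg h6.le (hDk k).le) (hw k).le
            have h8 := mul_le_mul_of_nonneg_right (hbx k) h7
            have h9 : w k * ((1 - ρ k) * (d k + D) / w k) = (1 - ρ k) * (d k + D) := by
              have := (hw k).ne'; field_simp
            rw [h5]
            nlinarith [mul_pos (hρ0 k) hD]
      _ = Fintype.card κ * D := by simp
  -- the mean squared distance
  have hM : ∑ i, ((c i - x i) ^ 2 + q i) ≤ θ * (E₀ + ε) := by
    rw [hblock]
    calc _ ≤ ∑ k, w k * θ := Finset.sum_le_sum fun k _ => by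
            have h5 : ∑ i with blk i = k, ((c i - x i) ^ 2 + q i) =
                (∑ i with blk i = k, x i ^ 2 / Λ (blk i)) * (θ * ρ k)
                  + d k * (w k * θ * (1 - ρ k) / (d k + D)) := by
              rw [Finset.sum_mul, ← hcard, ← Finset.sum_add_distrib]
              refine Finset.sum_congr rfl fun i hi => ?_
              rw [hqv, ← (Finset.mem_filter.1 hi).2]
              congr 1
              simp only [hc, hρ]
              have := (hΛ0 (blk i)).ne'
              field_simp
              ring
            have h8 := mul_le_mul_of_nonneg_right (hbx k) (mul_pos hθ (hρ0 k)).le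
            have h6 : 0 < 1 - ρ k := by linarith [hρ1 k]
            have h9 : d k * (w k * θ * (1 - ρ k) / (d k + D)) ≤ w k * θ * (1 - ρ k) := by
              rw [mul_div_assoc', div_le_iff₀ (hDk k), mul_comm]
              have := mul_pos (mul_pos (hw k) hθ) h6
              gcongr
              linarith
            rw [h5]
            nlinarith
      _ = θ * ∑ k, w k := by rw [← Finset.sum_mul, mul_comm]
      _ ≤ _ := by gcongr
  have hqQ : ∀ i, (q i : ℝ) ≤ 2 * θ / D := fun i => by
    rw [hqv]
    have h6 : 0 < 1 - ρ (blk i) := by linarith [hρ1 (blk i)]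
    have : w (blk i) * θ * (1 - ρ (blk i)) ≤ 2 * θ * 1 := by
      have := hw2 (blk i)
      have := (hρ0 (blk i)).le
      gcongr
      linarith
    rw [mul_one] at this
    gcongr
    linarith [hd0 (blk i)]
  have hll := integral_gaussianLLR (σ := σ) c hqne
  set B : Set (ι → ℝ) := {y | ∑ i, (y i - x i) ^ 2 ≤ θ * (E₀ + 2 * ε)} with hBdef
  have hB : MeasurableSet B := measurableSet_le (by fun_prop) measurable_const
  refine exp_neg_le_measureReal_of_withDensity (by unfold gaussianLLR; fun_prop)
    (pi_gaussianReal_eq_withDensity c hqne hσne)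
    hll.1 hB ?_ hε.le hKL ?_
  · have h1 : ∀ i, 0 ≤ Real.log (Λ (blk i) / θ) := fun i =>
      Real.log_nonneg ((one_le_div hθ).2 (hΛ _).le)
    have := Finset.sum_nonneg fun i (_ : i ∈ Finset.univ) => h1 i
    positivity
  · set Qm := Measure.pi fun i => gaussianReal (c i) (q i) with hQm
    set t := ε * D / (32 * θ) with ht
    have ht0 : 0 < t := by positivity
    have htQ : t * (2 * θ / D) = ε / 16 := by rw [ht]; field_simp; norm_num
    have hch := lintegral_exp_mul_sum_sub_sq_gaussian_le c x q hqne ht0.le hqQ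
      (by rw [htQ]; linarith)
    have hmk := mul_meas_ge_le_lintegral (μ := Qm)
      (f := fun y => ENNReal.ofReal (rexp (t * ∑ i, (y i - x i) ^ 2))) (by fun_prop)
      (ENNReal.ofReal (rexp (t * (θ * (E₀ + 2 * ε)))))
    have hsub : Bᶜ ⊆ {y | ENNReal.ofReal (rexp (t * (θ * (E₀ + 2 * ε)))) ≤
        ENNReal.ofReal (rexp (t * ∑ i, (y i - x i) ^ 2))} := by
      intro y hy
      simp only [hBdef, Set.mem_compl_iff, Set.mem_ofPred_eq, not_le] at hy
      simp only [Set.mem_ofPred_eq]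
      gcongr
    have h1 : ENNReal.ofReal (rexp (t * (θ * (E₀ + 2 * ε)))) * Qm Bᶜ ≤
        ENNReal.ofReal (rexp (t * (1 + 4 * t * (2 * θ / D)) * (θ * (E₀ + ε)))) := by
      refine (mul_le_mul_right (measure_mono hsub) _).trans (hmk.trans (hch.trans ?_))
      gcongr
    have h2 : rexp (t * (θ * (E₀ + 2 * ε))) * Qm.real Bᶜ ≤
        rexp (t * (1 + 4 * t * (2 * θ / D)) * (θ * (E₀ + ε))) := by
      have := ENNReal.toReal_mono ENNReal.ofReal_ne_top h1
      rwa [ENNReal.toReal_mul, ENNReal.toReal_ofReal (by positivity),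
        ENNReal.toReal_ofReal (by positivity)] at this
    have h3 : Qm.real Bᶜ ≤ rexp (-(ε ^ 2 * D / 64)) := by
      rw [← le_div_iff₀' (by positivity), ← Real.exp_sub] at h2
      refine h2.trans (Real.exp_le_exp.2 ?_)
      have e1 : 4 * t * (2 * θ / D) = ε / 4 := by rw [mul_assoc, htQ]; ring
      have e2 : t * θ = ε * D / 32 := by rw [ht]; field_simp
      have e3 : t * (1 + 4 * t * (2 * θ / D)) * (θ * (E₀ + ε)) - t * (θ * (E₀ + 2 * ε)) =
          (t * θ) * ((1 + ε / 4) * (E₀ + ε) - (E₀ + 2 * ε)) := by rw [e1]; ring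
      rw [e3, e2]
      have e4 : (1 + ε / 4) * (E₀ + ε) - (E₀ + 2 * ε) ≤ -(ε / 2) := by nlinarith
      calc ε * D / 32 * ((1 + ε / 4) * (E₀ + ε) - (E₀ + 2 * ε)) ≤ ε * D / 32 * (-(ε / 2)) := by
            gcongr
        _ = _ := by ring
    have h4 : Qm.real B = 1 - Qm.real Bᶜ := by
      rw [measureReal_compl hB]; simp
    rw [h4, div_le_iff₀ (by positivity)]
    nlinarith

/-- Rounding towards zero on a grid. -/
theorem exists_int_round_toward_zero {h : ℝ} (hh : 0 < h) (x : ℝ) :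
    ∃ z : ℤ, (h * z) ^ 2 ≤ x ^ 2 ∧ (x - h * z) ^ 2 ≤ h ^ 2 := by
  have key : ∀ x : ℝ, 0 ≤ x → ∃ z : ℤ, (h * z) ^ 2 ≤ x ^ 2 ∧ (x - h * z) ^ 2 ≤ h ^ 2 := by
    intro x hx
    have h0 : (0 : ℝ) ≤ ⌊x / h⌋ := by exact_mod_cast Int.floor_nonneg.2 (by positivity)
    have h1 : h * ⌊x / h⌋ ≤ x := by
      have := Int.floor_le (x / h)
      rwa [le_div_iff₀' hh] at this
    have h2 : x < h * ⌊x / h⌋ + h := by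
      have := Int.lt_floor_add_one (x / h)
      rw [div_lt_iff₀' hh] at this
      linarith
    refine ⟨⌊x / h⌋, ?_, ?_⟩
    · gcongr
    · have : 0 ≤ x - h * ⌊x / h⌋ := by linarith
      gcongr
      linarith
  rcases le_total 0 x with hx | hx
  · exact key x hx
  · obtain ⟨z, h1, h2⟩ := key (-x) (by linarith)
    refine ⟨-z, ?_, ?_⟩
    · push_cast; nlinarith
    · push_cast; nlinarith

/-- A covering of a finite-dimensional ellipsoid by random coding: the squared distance of `x` to
the codebook is controlled by the energy of `x`. -/
theorem exists_ellipsoid_cover {ι κ : Type*} [Fintype ι] [Fintype κ] [DecidableEq κ]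
    (blk : ι → κ) {lam : ι → ℝ} {Λ : κ → ℝ} {θ D ε h : ℝ} {L N : ℕ} (hθ : 0 < θ) (hD : 0 < D)
    (hε : 0 < ε) (hε1 : ε ≤ 1) (hΛ : ∀ k, θ < Λ k) (hlam : ∀ i, 0 < lam i)
    (hlamΛ : ∀ i, lam i ≤ Λ (blk i)) (hDε : rexp (-(ε ^ 2 * D / 64)) ≤ ε / 2)
    (hL : 0 < L) (hKL : (Fintype.card κ : ℝ) ≤ ε * L) (hh : 0 < h)
    (hhθ : Fintype.card ι * h ^ 2 ≤ θ * ε ^ 2 / 2) (hN : ∀ i, lam i ≤ (h * N) ^ 2) :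
    ∃ A : Finset (ι → ℝ),
      (A.card : ℝ) ≤ (L + 1) ^ Fintype.card κ * (Fintype.card ι * Real.log (2 * N + 1)) /
        rexp (-((1 + ε) * (((∑ i, Real.log (Λ (blk i) / θ)) / 2 + Fintype.card κ * D / 2)
        + Real.log 2))) + 1 ∧
      ∀ x : ι → ℝ, ∑ i, x i ^ 2 / lam i ≤ 1 →
        ∃ a ∈ A, ∑ i, (x i - a i) ^ 2 ≤ θ * (∑ i, x i ^ 2 / lam i + 6 * ε) := by
  classical
  set p := rexp (-((1 + ε) * (((∑ i, Real.log (Λ (blk i) / θ)) / 2 + Fintype.card κ * D / 2)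
        + Real.log 2))) with hp
  have hL0 : (0 : ℝ) < L := by exact_mod_cast hL
  let W : (κ → Fin (L + 1)) → κ → ℝ := fun v k => (v k + 1) / L
  let ν : (κ → Fin (L + 1)) → Measure (ι → ℝ) := fun v =>
    Measure.pi fun i => gaussianReal 0 (codeVar blk Λ θ D (W v) i)
  let μ : Measure (ι → ℝ) := ∑ v, ν v
  have hμr : ∀ s, μ.real s = ∑ v, (ν v).real s := fun s => by
    simp only [μ, measureReal_def, Measure.finsetSum_apply]
    rw [ENNReal.toReal_sum fun v _ => measure_ne_top _ _]
  let E : (ι → ℝ) → ℝ := fun x => ∑ i, x i ^ 2 / lam i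
  let g : (ι → ℤ) → ι → ℝ := fun z i => h * z i
  let B : (ι → ℤ) → Set (ι → ℝ) := fun z => {y | ∑ i, (y i - g z i) ^ 2 ≤ θ * (E (g z) + 2 * ε)}
  let S : Finset (ι → ℤ) :=
    (Fintype.piFinset fun _ => Finset.Icc (-(N : ℤ)) N).filter fun z => E (g z) ≤ 1
  have hS : ∀ z ∈ S, p ≤ μ.real (B z) := by
    intro z hz
    have hE := (Finset.mem_filter.1 hz).2
    set x := g z with hx
    set e : κ → ℝ := fun k => ∑ i with blk i = k, x i ^ 2 / lam i with he
    have he0 : ∀ k, 0 ≤ e k := fun k => Finset.sum_nonneg fun i _ => div_nonneg (sq_nonneg _) (hlam i).le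
    have hesum : ∑ k, e k = E x := Finset.sum_fiberwise Finset.univ blk _
    have he1 : ∀ k, e k ≤ 1 := fun k =>
      (Finset.single_le_sum (fun k _ => he0 k) (Finset.mem_univ k)).trans (hesum.trans_le hE)
    have hfl : ∀ k, ⌊L * e k⌋₊ < L + 1 := fun k => by
      refine Nat.lt_succ_of_le (Nat.floor_le_of_le ?_)
      have := mul_le_mul_of_nonneg_left (he1 k) hL0.le
      linarith
    set v : κ → Fin (L + 1) := fun k => ⟨⌊L * e k⌋₊, hfl k⟩ with hv
    have hW : ∀ k, W v k = (⌊L * e k⌋₊ + 1) / L := fun k => rfl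
    have hWl : ∀ k, e k ≤ W v k := fun k => by
      rw [hW, le_div_iff₀' hL0]
      exact (Nat.lt_floor_add_one _).le
    have hWu : ∀ k, W v k ≤ e k + 1 / L := fun k => by
      rw [hW, add_div]
      gcongr
      rw [div_le_iff₀' hL0]
      exact Nat.floor_le (mul_nonneg hL0.le (he0 k))
    have hL1 : 1 / (L : ℝ) ≤ 1 := by
      rw [div_le_one hL0]; exact_mod_cast hL
    have := exp_neg_le_codebook_ball blk (E₀ := E x) hθ hD hε hε1 hΛ hlam hlamΛ
      (w := W v) (fun k => by rw [hW]; positivity) (fun k => by linarith [hWu k, he1 k]) hE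
      (by
        calc ∑ k, W v k ≤ ∑ k, (e k + 1 / L) := Finset.sum_le_sum fun k _ => hWu k
          _ = E x + Fintype.card κ / L := by
            rw [Finset.sum_add_distrib, hesum]; simp [div_eq_mul_inv]
          _ ≤ _ := by
            gcongr
            rwa [div_le_iff₀ hL0]) hDε x hWl
    refine this.trans ?_
    rw [hμr]
    exact Finset.single_le_sum (f := fun v => (ν v).real (B z))
      (fun v _ => measureReal_nonneg) (Finset.mem_univ v)
  have hp1 : p ≤ 1 := by
    rw [hp, Real.exp_le_one_iff]
    have h1 : ∀ i, 0 ≤ Real.log (Λ (blk i) / θ) := fun i =>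
      Real.log_nonneg ((one_le_div hθ).2 (hΛ _).le)
    have h2 := Finset.sum_nonneg fun i (_ : i ∈ Finset.univ) => h1 i
    have h3 := Real.log_nonneg (x := 2) (by norm_num)
    have : 0 ≤ (1 + ε) * (((∑ i, Real.log (Λ (blk i) / θ)) / 2 + Fintype.card κ * D / 2)
        + Real.log 2) := by positivity
    linarith
  have hT : μ.real Set.univ ≤ (L + 1 : ℝ) ^ Fintype.card κ := by
    rw [hμr]; simp [ν]
  have hN1 : (1 : ℝ) ≤ 2 * N + 1 := by
    have : (0 : ℝ) ≤ N := Nat.cast_nonneg _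
    linarith
  obtain ⟨A, hA, hAS⟩ := exists_card_le_log_forall_mem_of_measure_ge μ hT (Real.exp_pos _)
    (hp1.trans (one_le_pow₀ (by linarith [Nat.cast_nonneg (α := ℝ) L]))) B
    (fun z => measurableSet_le (by fun_prop) measurable_const) S hS
    (M := Fintype.card ι * Real.log (2 * N + 1)) (by
      have h1 : S.card ≤ (2 * N + 1) ^ Fintype.card ι := by
        refine (Finset.card_filter_le _ _).trans ?_
        rw [Fintype.card_piFinset]
        simp only [Int.card_Icc, Finset.prod_const, Finset.card_univ]
        refine Nat.pow_le_pow_left ?_ _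
        omega
      calc (S.card : ℝ) ≤ (2 * N + 1 : ℝ) ^ Fintype.card ι := by exact_mod_cast h1
        _ = _ := by
          rw [← Real.log_pow, Real.exp_log (by positivity)])
    (mul_nonneg (Nat.cast_nonneg _) (Real.log_nonneg hN1))
  refine ⟨A, hA, fun x hx => ?_⟩
  choose z hz1 hz2 using fun i => exists_int_round_toward_zero hh (x i)
  have hEz : E (g z) ≤ E x := Finset.sum_le_sum fun i _ =>
    div_le_div_of_nonneg_right (hz1 i) (hlam i).le
  have hzS : z ∈ S := by
    refine Finset.mem_filter.2 ⟨Fintype.mem_piFinset.2 fun i => ?_, hEz.trans hx⟩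
    have h1 : x i ^ 2 / lam i ≤ 1 := (Finset.single_le_sum (f := fun i => x i ^ 2 / lam i)
      (fun i _ => div_nonneg (sq_nonneg _) (hlam i).le) (Finset.mem_univ i)).trans hx
    rw [div_le_one (hlam i)] at h1
    have h2 : (h * z i) ^ 2 ≤ (h * N) ^ 2 := (hz1 i).trans (h1.trans (hN i))
    rw [mul_pow, mul_pow] at h2
    have h3 := le_of_mul_le_mul_left h2 (by positivity)
    have h4 : (z i) ^ 2 ≤ (N : ℤ) ^ 2 := by exact_mod_cast h3
    have := abs_le_of_sq_le_sq' h4 (by positivity)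
    exact Finset.mem_Icc.2 this
  obtain ⟨a, ha, haB⟩ := hAS z hzS
  refine ⟨a, ha, ?_⟩
  have haB' : ∑ i, (a i - g z i) ^ 2 ≤ θ * (E (g z) + 2 * ε) := haB
  have hd : ∑ i, (x i - g z i) ^ 2 ≤ θ * ε ^ 2 / 2 := by
    refine le_trans ?_ hhθ
    calc _ ≤ ∑ i : ι, h ^ 2 := Finset.sum_le_sum fun i _ => hz2 i
      _ = _ := by simp
  have hsq : ∀ p q : ℝ, (p - q) ^ 2 ≤ (1 + ε) * q ^ 2 + (2 / ε) * p ^ 2 := fun p q => by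
    have h1 : 1 ≤ 1 / ε := by rw [le_div_iff₀ hε]; linarith
    have h2 : (1 + ε) * q ^ 2 + (1 + 1 / ε) * p ^ 2 - (p - q) ^ 2 = (ε * q + p) ^ 2 / ε := by
      field_simp; ring
    have h3 : 0 ≤ (ε * q + p) ^ 2 / ε := by positivity
    have h4 : 2 / ε = 1 / ε + 1 / ε := by ring
    rw [h4]
    nlinarith [sq_nonneg p]
  calc ∑ i, (x i - a i) ^ 2 ≤ ∑ i, ((1 + ε) * (a i - g z i) ^ 2 + (2 / ε) * (x i - g z i) ^ 2) :=
        Finset.sum_le_sum fun i _ => by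
          have := hsq (x i - g z i) (a i - g z i)
          rwa [sub_sub_sub_cancel_right] at this
    _ = (1 + ε) * ∑ i, (a i - g z i) ^ 2 + (2 / ε) * ∑ i, (x i - g z i) ^ 2 := by
        rw [Finset.sum_add_distrib, Finset.mul_sum, Finset.mul_sum]
    _ ≤ (1 + ε) * (θ * (E x + 2 * ε)) + (2 / ε) * (θ * ε ^ 2 / 2) := by
        gcongr
        exact haB'.trans (by gcongr)
    _ = θ * ((1 + ε) * (E x + 2 * ε) + ε) := by field_simp
    _ ≤ _ := by
        have hx' : E x ≤ 1 := hx
        refine mul_le_mul_of_nonneg_left ?_ hθ.le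
        change _ ≤ E x + 6 * ε
        nlinarith

theorem eventually_mul_log_add_mul_log_le (a c : ℝ) {δ : ℝ} (hδ : 0 < δ) :
    ∀ᶠ m : ℕ in atTop, (a * Real.log m + c) * Real.log (m + 1) ≤ δ * m := by
  have h1 := (isLittleO_pow_log_id_atTop (n := 2)).comp_tendsto tendsto_natCast_atTop_atTop
  have h2 := h1.bound (c := δ / (2 * (|a| + |c|) + 1)) (by positivity)
  filter_upwards [h2, eventually_ge_atTop 3] with m hm hm3
  have hm3' : (3 : ℝ) ≤ m := by exact_mod_cast hm3
  have hl : 1 ≤ Real.log m := by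
    rw [Real.le_log_iff_exp_le (by linarith)]
    linarith [Real.exp_one_lt_d9]
  have hl2 : Real.log (m + 1) ≤ 2 * Real.log m := by
    have : Real.log (m + 1) ≤ Real.log (m ^ 2) := Real.log_le_log (by linarith) (by nlinarith)
    rwa [Real.log_pow] at this
  have hl3 : 0 ≤ Real.log (m + 1) := Real.log_nonneg (by linarith)
  simp only [Function.comp, id, Real.norm_eq_abs, abs_pow, sq_abs, Nat.abs_cast] at hm
  calc (a * Real.log m + c) * Real.log (m + 1) ≤ ((|a| + |c|) * Real.log m) * Real.log (m + 1) := by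
        gcongr
        nlinarith [le_abs_self a, le_abs_self c, abs_nonneg c, mul_le_mul_of_nonneg_right (le_abs_self a) (by linarith : 0 ≤ Real.log m)]
    _ ≤ ((|a| + |c|) * Real.log m) * (2 * Real.log m) := by gcongr
    _ = 2 * (|a| + |c|) * Real.log m ^ 2 := by ring
    _ ≤ (2 * (|a| + |c|) + 1) * Real.log m ^ 2 := by gcongr; linarith
    _ ≤ (2 * (|a| + |c|) + 1) * (δ / (2 * (|a| + |c|) + 1) * m) := by gcongr
    _ = δ * m := by field_simp

theorem eventually_const_mul_pow_le_exp (c : ℝ) (k : ℕ) {δ : ℝ} (hδ : 0 < δ) :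
    ∀ᶠ m : ℕ in atTop, c * (m : ℝ) ^ k ≤ rexp (δ * m) := by
  have h1 := (isLittleO_pow_exp_pos_mul_atTop k hδ).comp_tendsto tendsto_natCast_atTop_atTop
  have h2 := h1.bound (c := 1 / (|c| + 1)) (by positivity)
  filter_upwards [h2] with m hm
  simp only [Function.comp, Real.norm_eq_abs, abs_pow, Nat.abs_cast, Real.abs_exp] at hm
  calc c * (m : ℝ) ^ k ≤ (|c| + 1) * (m : ℝ) ^ k := by gcongr; linarith [le_abs_self c]
    _ ≤ (|c| + 1) * (1 / (|c| + 1) * rexp (δ * m)) := by gcongr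
    _ = _ := by field_simp

set_option maxHeartbeats 1000000 in
theorem eventually_exists_ellipsoid_cover {lam : ℕ → ℝ} (hpos : ∀ j, 0 < lam j)
    (hanti : Antitone lam) {b : ℝ} (hb : 0 < b)
    (hlog : Tendsto (fun m : ℕ => (∑ j ∈ Finset.range m, Real.log (lam j / lam m)) / m) atTop
      (nhds b))
    {C : ℕ} (hC : ∀ᶠ m : ℕ in atTop, 1 ≤ (m : ℝ) ^ C * lam m) {ε₀ : ℝ} (hε₀ : 0 < ε₀) :
    ∀ᶠ m : ℕ in atTop, ∃ A : Finset (Fin m → ℝ), (A.card : ℝ) ≤ rexp ((b / 2 + ε₀) * m) ∧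
      ∀ x : Fin m → ℝ, ∑ i, x i ^ 2 / lam i ≤ 1 →
        ∃ a ∈ A, ∑ i, (x i - a i) ^ 2 ≤ lam m * (∑ i, x i ^ 2 / lam i + ε₀) := by
  set ε := min 1 (ε₀ / (8 + b)) with hεdef
  have hε : 0 < ε := lt_min one_pos (by positivity)
  have hε1 : ε ≤ 1 := min_le_left _ _
  have hε2 : ε * (8 + b) ≤ ε₀ := by
    rw [← le_div_iff₀ (by positivity)]; exact min_le_right _ _
  set δ := min (ε / 2) (ε ^ 3 / (64 * (Real.log (2 / ε) + 1))) with hδdef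
  have hl2 : 0 ≤ Real.log (2 / ε) := Real.log_nonneg (by rw [le_div_iff₀ hε]; linarith)
  have hδ : 0 < δ := lt_min (by positivity) (by positivity)
  filter_upwards [hC, hlog.eventually_le_const (show b < b + ε by linarith),
    eventually_mul_log_add_mul_log_le (C / ε) (Real.log (lam 0) / ε + 1) hδ,
    eventually_const_mul_pow_le_exp (4 + 4 * lam 0 / ε ^ 2) (C + 2) hε,
    eventually_const_mul_pow_le_exp 4 0 hε,
    eventually_ge_atTop 3] with m hCm hlogm hK hpoly h4m hm3
  have hm3' : (3 : ℝ) ≤ m := by exact_mod_cast hm3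
  have hm0 : (0 : ℝ) < m := by linarith
  have hm1 : 1 ≤ Real.log (m + 1) := by
    rw [Real.le_log_iff_exp_le (by linarith)]
    linarith [Real.exp_one_lt_d9]
  set θ := lam m with hθdef
  have hθ : 0 < θ := hpos m
  have hlg0 : ∀ i, i ≤ m → 0 ≤ Real.log (lam i / θ) := fun i hi =>
    Real.log_nonneg ((one_le_div hθ).2 (hanti hi))
  have hlg1 : ∀ i, Real.log (lam i / θ) ≤ Real.log (lam 0 / θ) := fun i =>
    Real.log_le_log (div_pos (hpos _) hθ) (by gcongr; exact hanti (Nat.zero_le _))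
  set K := ⌊Real.log (lam 0 / θ) / ε⌋₊ + 1 with hKdef
  have hKle : (K : ℝ) ≤ C / ε * Real.log m + (Real.log (lam 0) / ε + 1) := by
    have h1 : (K : ℝ) ≤ Real.log (lam 0 / θ) / ε + 1 := by
      rw [hKdef]; push_cast
      gcongr
      exact Nat.floor_le (div_nonneg (hlg0 0 (Nat.zero_le _)) hε.le)
    have h2 : Real.log (lam 0 / θ) ≤ Real.log (lam 0) + C * Real.log m := by
      rw [Real.log_div (hpos 0).ne' hθ.ne']
      have h3 := Real.log_nonneg hCm
      rw [Real.log_mul (by positivity) hθ.ne', Real.log_pow] at h3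
      linarith
    refine h1.trans ?_
    rw [← add_assoc]
    gcongr
    calc _ ≤ (Real.log (lam 0) + C * Real.log m) / ε := by gcongr
      _ = _ := by ring
  have hKm : (K : ℝ) * Real.log (m + 1) ≤ δ * m :=
    (mul_le_mul_of_nonneg_right hKle (by linarith)).trans hK
  have hK0 : (0 : ℝ) < K := by rw [hKdef]; positivity
  have hKδ : (K : ℝ) ≤ δ * m := by nlinarith
  set blk : Fin m → Fin K := fun i => ⟨⌊Real.log (lam i / θ) / ε⌋₊, by
    rw [hKdef]
    refine Nat.lt_succ_of_le (Nat.floor_le_floor ?_)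
    exact div_le_div_of_nonneg_right (hlg1 i) hε.le⟩ with hblk
  set Λ : Fin K → ℝ := fun k => θ * rexp (ε * (k + 1)) with hΛdef
  have hΛlog : ∀ k, Real.log (Λ k / θ) = ε * (k + 1) := fun k => by
    rw [hΛdef]
    simp only
    rw [mul_div_cancel_left₀ _ hθ.ne', Real.log_exp]
  set D := ε * m / K with hDdef
  have hD : 0 < D := by positivity
  set h := √(θ * ε ^ 2 / (2 * m)) with hhdef
  have hh : 0 < h := Real.sqrt_pos.2 (by positivity)
  have hh2 : h ^ 2 = θ * ε ^ 2 / (2 * m) := Real.sq_sqrt (by positivity)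
  set N := ⌈√(lam 0) / h⌉₊ with hNdef
  obtain ⟨A, hA, hAx⟩ := exists_ellipsoid_cover (ε := ε) (L := m) (N := N) (D := D) (h := h)
    blk (lam := fun i => lam i) (Λ := Λ) hθ hD
    hε hε1 (fun k => by
      have : 1 < rexp (ε * (k + 1)) := Real.one_lt_exp_iff.2 (by positivity)
      simp only [hΛdef]
      nlinarith) (fun i => hpos i)
    (fun i => by
      have h1 := (Nat.lt_floor_add_one (Real.log (lam i / θ) / ε)).le
      rw [div_le_iff₀' hε] at h1
      have h2 := Real.exp_le_exp.2 h1
      rw [Real.exp_log (div_pos (hpos _) hθ), div_le_iff₀' hθ] at h2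
      exact h2)
    (by
      rw [← Real.le_log_iff_exp_le (by positivity), ← neg_neg (Real.log (ε / 2)), ← Real.log_inv,
        inv_div]
      refine neg_le_neg ?_
      have h1 : (K : ℝ) * (64 * (Real.log (2 / ε) + 1)) ≤ ε ^ 3 * m := by
        have h2 : δ * (64 * (Real.log (2 / ε) + 1)) ≤ ε ^ 3 := by
          rw [← le_div_iff₀ (by positivity)]; exact min_le_right _ _
        calc (K : ℝ) * (64 * (Real.log (2 / ε) + 1)) ≤ δ * m * (64 * (Real.log (2 / ε) + 1)) := by
              gcongr
          _ = δ * (64 * (Real.log (2 / ε) + 1)) * m := by ring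
          _ ≤ _ := by gcongr
      rw [hDdef, le_div_iff₀ (by norm_num), mul_div_assoc', le_div_iff₀ hK0]
      nlinarith)
    (by omega)
    (by
      rw [Fintype.card_fin]
      refine hKδ.trans ?_
      gcongr
      exact (min_le_left _ _).trans (by linarith))
    hh
    (by
      rw [Fintype.card_fin, hh2]
      apply le_of_eq
      field_simp)
    (fun i => by
      have h1 : √(lam 0) ≤ h * N := by
        have := Nat.le_ceil (√(lam 0) / h)
        rwa [div_le_iff₀' hh] at this
      calc lam i ≤ lam 0 := hanti (Nat.zero_le _)
        _ = √(lam 0) ^ 2 := (Real.sq_sqrt (hpos 0).le).symm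
        _ ≤ _ := by gcongr)
  refine ⟨A, hA.trans ?_, fun x hx => ?_⟩
  · rw [Fintype.card_fin, Fintype.card_fin, div_eq_mul_inv, ← Real.exp_neg, neg_neg]
    have e1 : ((m : ℝ) + 1) ^ K ≤ rexp (ε * m) := by
      rw [← Real.rpow_natCast, Real.rpow_def_of_pos (by positivity), mul_comm]
      refine Real.exp_le_exp.2 (hKm.trans ?_)
      gcongr
      exact (min_le_left _ _).trans (by linarith)
    have e2 : (m : ℝ) * Real.log (2 * N + 1) ≤ rexp (ε * m) := by
      refine le_trans ?_ hpoly
      have hN : (N : ℝ) ≤ 2 + 2 * lam 0 / ε ^ 2 * m ^ (C + 1) := by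
        have h1 : (N : ℝ) ≤ √(lam 0) / h + 1 := (Nat.ceil_lt_add_one (by positivity)).le
        have h2 : √(lam 0) / h ≤ 1 + (√(lam 0) / h) ^ 2 := by
          nlinarith [sq_nonneg (√(lam 0) / h - 1)]
        have h3 : (√(lam 0) / h) ^ 2 ≤ 2 * lam 0 / ε ^ 2 * m ^ (C + 1) := by
          rw [div_pow, Real.sq_sqrt (hpos 0).le, hh2]
          rw [div_le_iff₀ (by positivity)]
          have : 2 * lam 0 / ε ^ 2 * m ^ (C + 1) * (θ * ε ^ 2 / (2 * m)) =
              lam 0 * ((m : ℝ) ^ C * θ) := by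
            field_simp
            ring
          rw [this]
          exact le_mul_of_one_le_right (hpos 0).le hCm
        linarith
      have h5 : Real.log (2 * N + 1) ≤ 2 * N := by
        have := Real.log_le_sub_one_of_pos (show (0 : ℝ) < 2 * N + 1 by positivity)
        linarith
      have h6 : (1 : ℝ) ≤ m ^ (C + 1) := one_le_pow₀ (by linarith)
      calc (m : ℝ) * Real.log (2 * N + 1) ≤ m * (2 * (2 + 2 * lam 0 / ε ^ 2 * m ^ (C + 1))) := by
            gcongr; linarith
        _ ≤ m * ((4 + 4 * lam 0 / ε ^ 2) * m ^ (C + 1)) := by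
            refine mul_le_mul_of_nonneg_left ?_ hm0.le
            have : 4 * lam 0 / ε ^ 2 = 2 * (2 * lam 0 / ε ^ 2) := by ring
            rw [this]
            nlinarith
        _ = _ := by ring
    have e3 : (∑ i, Real.log (Λ (blk i) / θ)) ≤ (b + 2 * ε) * m := by
      calc _ ≤ ∑ i : Fin m, (Real.log (lam i / θ) + ε) := Finset.sum_le_sum fun i _ => by
            rw [hΛlog]
            have : ((blk i : ℕ) : ℝ) ≤ Real.log (lam i / θ) / ε :=
              Nat.floor_le (div_nonneg (hlg0 _ i.2.le) hε.le)
            rw [le_div_iff₀' hε] at this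
            linarith
        _ = ∑ j ∈ Finset.range m, Real.log (lam j / θ) + ε * m := by
            rw [Finset.sum_add_distrib,
              Fin.sum_univ_eq_sum_range (fun j => Real.log (lam j / θ)) m]
            simp [mul_comm]
        _ ≤ _ := by
            rw [div_le_iff₀ hm0] at hlogm
            linarith
    have e4 : (K : ℝ) * D = ε * m := by rw [hDdef]; field_simp
    have e5 : Real.log 2 + Real.log 2 ≤ ε * m := by
      have h2 : (2 : ℝ) * 2 ≤ rexp (ε * m) := by linarith [h4m]
      rw [← Real.log_mul (by norm_num) (by norm_num)]
      exact (Real.log_le_iff_le_exp (by norm_num)).2 h2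
    have hl2' : 0 ≤ Real.log 2 := Real.log_nonneg (by norm_num)
    have e7 : (1 + ε) * (((∑ i, Real.log (Λ (blk i) / θ)) / 2 + K * D / 2) + Real.log 2) ≤
        (1 + ε) * ((b + 3 * ε) / 2 * m) + ε * m := by
      rw [e4]
      nlinarith
    have hlogN : 0 ≤ Real.log (2 * N + 1) :=
      Real.log_nonneg (by linarith [Nat.cast_nonneg (α := ℝ) N])
    have e8 : 1 ≤ rexp (ε * m + ε * m + ((1 + ε) * ((b + 3 * ε) / 2 * m) + ε * m)) :=
      Real.one_le_exp (by positivity)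
    calc _ ≤ rexp (ε * m) * rexp (ε * m) * rexp ((1 + ε) * ((b + 3 * ε) / 2 * m) + ε * m) + 1 := by
          gcongr
      _ = rexp (ε * m + ε * m + ((1 + ε) * ((b + 3 * ε) / 2 * m) + ε * m)) + 1 := by
          rw [← Real.exp_add, ← Real.exp_add]
      _ ≤ 2 * rexp (ε * m + ε * m + ((1 + ε) * ((b + 3 * ε) / 2 * m) + ε * m)) := by linarith
      _ ≤ rexp (ε * m) * rexp (ε * m + ε * m + ((1 + ε) * ((b + 3 * ε) / 2 * m) + ε * m)) := by
          gcongr; linarith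
      _ = rexp ((b / 2 + 4 * ε + 3 * ε / 2 + ε * b / 2 + 3 * ε * ε / 2) * m) := by
          rw [← Real.exp_add]; ring_nf
      _ ≤ _ := by
          refine Real.exp_le_exp.2 (mul_le_mul_of_nonneg_right ?_ hm0.le)
          nlinarith
  · obtain ⟨a, ha, h1⟩ := hAx x hx
    refine ⟨a, ha, h1.trans ?_⟩
    gcongr
    nlinarith

theorem Orthonormal.hasSum_inner_sq_of_mem_closure_span {H : Type*} [NormedAddCommGroup H]
    [InnerProductSpace ℝ H] [CompleteSpace H] {u : ℕ → H} (hu : Orthonormal ℝ u) {x : H}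
    (hx : x ∈ closure (Submodule.span ℝ (Set.range u) : Set H)) :
    HasSum (fun j => ⟪x, u j⟫ ^ 2) (‖x‖ ^ 2) := by
  set S := (Submodule.span ℝ (Set.range u)).topologicalClosure with hS
  have hmem : ∀ j, u j ∈ S := fun j =>
    Submodule.le_topologicalClosure _ (Submodule.subset_span ⟨j, rfl⟩)
  have : CompleteSpace S := (Submodule.isClosed_topologicalClosure _).completeSpace_coe
  set v : ℕ → S := fun j => ⟨u j, hmem j⟩ with hv
  have hvo : Orthonormal ℝ v := by
    rw [← S.subtypeₗᵢ.orthonormal_comp_iff]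
    exact hu
  have hbot : (Submodule.span ℝ (Set.range v))ᗮ = ⊥ := by
    rw [Submodule.eq_bot_iff]
    intro w hw
    have h1 : ∀ j, ⟪u j, (w : H)⟫ = 0 := fun j =>
      (Submodule.mem_orthogonal _ _).1 hw (v j) (Submodule.subset_span ⟨j, rfl⟩)
    have h2 : (w : H) ∈ (Submodule.span ℝ (Set.range u))ᗮ := by
      rw [Submodule.mem_orthogonal]
      intro y hy
      induction hy using Submodule.span_induction with
      | mem y hy => obtain ⟨j, rfl⟩ := hy; exact h1 j
      | zero => simp
      | add y z _ _ h h' => rw [inner_add_left, h, h', add_zero]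
      | smul a y _ h => rw [inner_smul_left, h, mul_zero]
    rw [← Submodule.orthogonal_closure] at h2
    have h3 : (w : H) ∈ S ⊓ Sᗮ := ⟨w.2, h2⟩
    rw [Submodule.inf_orthogonal_eq_bot] at h3
    exact Subtype.ext h3
  let B := HilbertBasis.mkOfOrthogonalEqBot hvo hbot
  have hB : ⇑B = v := HilbertBasis.coe_mkOfOrthogonalEqBot hvo hbot
  have hx' : x ∈ S := hx
  have := B.hasSum_inner_mul_inner (⟨x, hx'⟩ : S) ⟨x, hx'⟩
  rw [hB, real_inner_self_eq_norm_sq] at this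
  have hfun : (fun j => ⟪x, u j⟫ ^ 2) = fun j => ⟪x, u j⟫ * ⟪u j, x⟫ := by
    ext j
    rw [real_inner_comm x, sq]
  rw [hfun]
  exact this

theorem Orthonormal.norm_sub_sum_sq {H : Type*} [NormedAddCommGroup H]
    [InnerProductSpace ℝ H] [CompleteSpace H] {u : ℕ → H} (hu : Orthonormal ℝ u) {x : H}
    (hx : x ∈ closure (Submodule.span ℝ (Set.range u) : Set H)) {m : ℕ} (a : Fin m → ℝ) :
    ‖x - ∑ i, a i • u i‖ ^ 2 = ∑ i : Fin m, (⟪x, u i⟫ - a i) ^ 2 + ∑' j, ⟪x, u (j + m)⟫ ^ 2 := by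
  have hsp : ∑ i, a i • u i ∈ Submodule.span ℝ (Set.range u) :=
    Submodule.sum_mem _ fun i _ => Submodule.smul_mem _ _ (Submodule.subset_span ⟨i, rfl⟩)
  have hmem : x - ∑ i, a i • u i ∈ closure (Submodule.span ℝ (Set.range u) : Set H) :=
    (Submodule.span ℝ (Set.range u)).topologicalClosure.sub_mem hx
      (Submodule.le_topologicalClosure _ hsp)
  have h := hu.hasSum_inner_sq_of_mem_closure_span hmem
  rw [← h.tsum_eq, ← h.summable.sum_add_tsum_nat_add m, ← Fin.sum_univ_eq_sum_range]
  have hin : ∀ j, ⟪∑ i, a i • u i, u j⟫ = ∑ i : Fin m, if (i : ℕ) = j then a i else 0 := fun j => by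
    rw [sum_inner]
    refine Finset.sum_congr rfl fun i _ => ?_
    rw [real_inner_smul_left, orthonormal_iff_ite.1 hu]
    simp
  congr 1
  · refine Finset.sum_congr rfl fun i _ => ?_
    rw [inner_sub_left, hin]
    simp [Fin.val_inj]
  · refine tsum_congr fun j => ?_
    rw [inner_sub_left, hin, Finset.sum_eq_zero, sub_zero]
    intro i _
    rw [if_neg]
    omega

theorem entropyNum_le {H : Type*} [NormedAddCommGroup H] {K : Set H} {n : ℕ} {α : Finset H} {r : ℝ}
    (hα : α.Nonempty) (hn : α.card ≤ n) (hr : 0 ≤ r) (h : ∀ x ∈ K, ∃ a ∈ α, ‖x - a‖ ≤ r) :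
    entropyNum K n ≤ r := by
  have hinf : ∀ (β : Finset H) (x : H), 0 ≤ sInf ((fun a => ‖x - a‖) '' (β : Set H)) := fun β x =>
    Real.sInf_nonneg (by rintro _ ⟨a, _, rfl⟩; exact norm_nonneg _)
  refine le_trans (csInf_le (a := sSup ((fun x => sInf ((fun a => ‖x - a‖) '' (α : Set H))) '' K))
    ⟨0, ?_⟩ ⟨α, hα, hn, rfl⟩) (Real.sSup_le ?_ hr)
  · rintro _ ⟨β, -, -, rfl⟩
    exact Real.sSup_nonneg (by rintro _ ⟨x, _, rfl⟩; exact hinf β x)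
  · rintro _ ⟨x, hx, rfl⟩
    obtain ⟨a, ha, hxa⟩ := h x hx
    exact (csInf_le ⟨0, by rintro _ ⟨a, _, rfl⟩; exact norm_nonneg _⟩
      (Set.mem_image_of_mem _ (Finset.mem_coe.2 ha))).trans hxa

theorem entropyNum_nonneg {H : Type*} [NormedAddCommGroup H] (K : Set H) (n : ℕ) :
    0 ≤ entropyNum K n := by
  refine Real.sInf_nonneg ?_
  rintro _ ⟨β, -, -, rfl⟩
  refine Real.sSup_nonneg ?_
  rintro _ ⟨x, _, rfl⟩
  exact Real.sInf_nonneg (by rintro _ ⟨a, _, rfl⟩; exact norm_nonneg _)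

theorem exists_cover_of_entropyNum_lt {H : Type*} [NormedAddCommGroup H] {K : Set H} {n : ℕ}
    (hn : 1 ≤ n) {R r : ℝ} (hK : ∀ x ∈ K, ‖x‖ ≤ R) (hr : entropyNum K n < r) :
    ∃ α : Finset H, α.Nonempty ∧ α.card ≤ n ∧ ∀ x ∈ K, ∃ a ∈ α, ‖x - a‖ < r := by
  have hne : { r : ℝ | ∃ α : Finset H, α.Nonempty ∧ α.card ≤ n ∧
      r = sSup ((fun x => sInf ((fun a => ‖x - a‖) '' (α : Set H))) '' K) }.Nonempty :=
    ⟨_, {0}, Finset.singleton_nonempty _, by simpa using hn, rfl⟩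
  obtain ⟨_, ⟨α, hα, hαn, rfl⟩, hlt⟩ := exists_lt_of_csInf_lt hne hr
  refine ⟨α, hα, hαn, fun x hx => ?_⟩
  have hfin : ((fun a => ‖x - a‖) '' (α : Set H)).Finite := α.finite_toSet.image _
  obtain ⟨a, ha, hxa⟩ := (Set.Nonempty.image (fun a => ‖x - a‖) hα).csInf_mem hfin
  refine ⟨a, ha, lt_of_le_of_lt ?_ hlt⟩
  simp only at hxa
  rw [hxa]
  refine le_csSup ?_ ⟨x, hx, rfl⟩
  obtain ⟨a₀, ha₀⟩ := hα
  refine ⟨R + ‖a₀‖, ?_⟩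
  rintro _ ⟨y, hy, rfl⟩
  calc sInf ((fun a => ‖y - a‖) '' (α : Set H)) ≤ ‖y - a₀‖ := csInf_le ⟨0, by rintro _ ⟨a, _, rfl⟩; exact norm_nonneg _⟩
        (Set.mem_image_of_mem (fun a => ‖y - a‖) (Finset.mem_coe.2 ha₀))
    _ ≤ ‖y‖ + ‖a₀‖ := norm_sub_le _ _
    _ ≤ _ := by linarith [hK y hy]

theorem eventually_entropyNum_sq_le {H : Type*} [NormedAddCommGroup H] [InnerProductSpace ℝ H]
    [CompleteSpace H] {u : ℕ → H} (hu : Orthonormal ℝ u) {lam : ℕ → ℝ} (hpos : ∀ j, 0 < lam j)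
    (hanti : Antitone lam) {b : ℝ} (hb : 0 < b)
    (hlog : Tendsto (fun m : ℕ => (∑ j ∈ Finset.range m, Real.log (lam j / lam m)) / m) atTop
      (nhds b))
    {C : ℕ} (hC : ∀ᶠ m : ℕ in atTop, 1 ≤ (m : ℝ) ^ C * lam m) {ε : ℝ} (hε : 0 < ε) :
    ∀ᶠ m : ℕ in atTop, ∀ n : ℕ, rexp ((b / 2 + ε) * m) ≤ n →
      entropyNum {x ∈ closure (Submodule.span ℝ (Set.range u) : Set H) |
        Summable (fun j => ⟪x, u j⟫ ^ 2 / lam j) ∧ ∑' j, ⟪x, u j⟫ ^ 2 / lam j ≤ 1} n ^ 2 ≤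
      lam m * (1 + ε) := by
  classical
  filter_upwards [eventually_exists_ellipsoid_cover hpos hanti hb hlog hC hε] with m hm n hn
  obtain ⟨A, hA, hAx⟩ := hm
  have hr : 0 ≤ lam m * (1 + ε) := mul_nonneg (hpos m).le (by linarith)
  rw [← Real.sqrt_le_sqrt_iff hr, Real.sqrt_sq (entropyNum_nonneg _ _)]
  refine entropyNum_le (α := A.image fun a => ∑ i : Fin m, a i • u i) ?_ ?_ (Real.sqrt_nonneg _) ?_
  · obtain ⟨a, ha, -⟩ := hAx 0 (by simp)
    exact ⟨_, Finset.mem_image_of_mem _ ha⟩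
  · refine Finset.card_image_le.trans ?_
    exact_mod_cast hA.trans hn
  · rintro x ⟨hx, hxs, hx1⟩
    have hnn : ∀ j, 0 ≤ ⟪x, u j⟫ ^ 2 / lam j := fun j => div_nonneg (sq_nonneg _) (hpos j).le
    rw [← hxs.sum_add_tsum_nat_add m, ← Fin.sum_univ_eq_sum_range] at hx1
    obtain ⟨a, ha, hxa⟩ := hAx (fun i => ⟪x, u i⟫)
      (by
        have : 0 ≤ ∑' j, ⟪x, u (j + m)⟫ ^ 2 / lam (j + m) := tsum_nonneg fun j => hnn (j + m)
        linarith)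
    refine ⟨_, Finset.mem_image_of_mem _ ha, ?_⟩
    rw [Real.le_sqrt (norm_nonneg _) hr, hu.norm_sub_sum_sq hx]
    have htail : ∑' j, ⟪x, u (j + m)⟫ ^ 2 ≤ lam m * ∑' j, ⟪x, u (j + m)⟫ ^ 2 / lam (j + m) := by
      rw [← tsum_mul_left]
      refine Summable.tsum_le_tsum (fun j => ?_) ?_ ?_
      · rw [mul_div_assoc', le_div_iff₀ (hpos _), mul_comm]
        gcongr
        exact hanti (by omega)
      · exact (summable_nat_add_iff m).2 (hu.hasSum_inner_sq_of_mem_closure_span hx).summable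
      · exact ((summable_nat_add_iff m).2 hxs).mul_left _
    have := mul_le_mul_of_nonneg_left hx1 (hpos m).le
    linarith

section GaussianVector

variable {H : Type*} [NormedAddCommGroup H] [InnerProductSpace ℝ H]
  {Ω : Type*} [MeasurableSpace Ω] {P : Measure Ω} {X : Ω → H}

theorem integrable_inner_mul_inner (hXmeas : AEStronglyMeasurable X P)
    (hXint : Integrable (fun ω => ‖X ω‖ ^ 2) P) (x y : H) :
    Integrable (fun ω => ⟪x, X ω⟫ * ⟪y, X ω⟫) P := by
  refine (hXint.const_mul (‖x‖ * ‖y‖)).mono' (by fun_prop) (ae_of_all _ fun ω => ?_)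
  rw [norm_mul]
  calc ‖⟪x, X ω⟫‖ * ‖⟪y, X ω⟫‖ ≤ (‖x‖ * ‖X ω‖) * (‖y‖ * ‖X ω‖) := by
        gcongr <;> exact norm_inner_le_norm _ _
    _ = _ := by ring

theorem integral_inner_sum_smul_sq (hXmeas : AEStronglyMeasurable X P)
    (hXint : Integrable (fun ω => ‖X ω‖ ^ 2) P) {u : ℕ → H} (hu : Orthonormal ℝ u) {lam : ℕ → ℝ}
    (heig : ∀ j, ∀ y : H, ∫ ω, ⟪u j, X ω⟫ * ⟪y, X ω⟫ ∂P = lam j * ⟪u j, y⟫) {m : ℕ}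
    (t : Fin m → ℝ) :
    ∫ ω, ⟪∑ i, t i • u i, X ω⟫ ^ 2 ∂P = ∑ i, t i ^ 2 * lam i := by
  set y := ∑ i, t i • u i with hy
  have h1 : ∀ ω, ⟪y, X ω⟫ ^ 2 = ∑ i : Fin m, t i * (⟪u i, X ω⟫ * ⟪y, X ω⟫) := fun ω => by
    have : ⟪y, X ω⟫ = ∑ i : Fin m, t i * ⟪u i, X ω⟫ := by
      rw [hy, sum_inner]
      exact Finset.sum_congr rfl fun i _ => real_inner_smul_left _ _ _
    rw [sq]
    nth_rewrite 1 [this]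
    rw [Finset.sum_mul]
    exact Finset.sum_congr rfl fun i _ => by ring
  simp_rw [h1]
  rw [integral_finsetSum _ fun i _ => (integrable_inner_mul_inner hXmeas hXint _ _).const_mul _]
  refine Finset.sum_congr rfl fun i _ => ?_
  have h2 : ⟪u i, y⟫ = t i := by
    rw [hy, inner_sum]
    simp [real_inner_smul_right, orthonormal_iff_ite.1 hu, Fin.val_inj]
  rw [integral_const_mul, heig, h2]
  ring

theorem map_inner_eq_pi_gaussianReal [IsProbabilityMeasure P] (hXmeas : AEStronglyMeasurable X P)
    (hXint : Integrable (fun ω => ‖X ω‖ ^ 2) P)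
    (hGauss : ∀ y : H, ∃ v : ℝ≥0, Measure.map (fun ω => ⟪y, X ω⟫) P = gaussianReal 0 v)
    {u : ℕ → H} (hu : Orthonormal ℝ u) {lam : ℕ → ℝ} (hpos : ∀ j, 0 < lam j)
    (heig : ∀ j, ∀ y : H, ∫ ω, ⟪u j, X ω⟫ * ⟪y, X ω⟫ ∂P = lam j * ⟪u j, y⟫) (m : ℕ) :
    Measure.map (fun ω (i : Fin m) => ⟪u i, X ω⟫) P =
      Measure.pi fun i : Fin m => gaussianReal 0 (lam i).toNNReal := by
  have hin : ∀ y : H, AEMeasurable (fun ω => ⟪y, X ω⟫) P := fun y =>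
    AEStronglyMeasurable.aemeasurable (by fun_prop)
  have hZ : AEMeasurable (fun ω (i : Fin m) => ⟪u i, X ω⟫) P :=
    aemeasurable_pi_lambda _ fun i => hin _
  have : IsProbabilityMeasure (Measure.map (fun ω (i : Fin m) => ⟪u i, X ω⟫) P) :=
    Measure.isProbabilityMeasure_map hZ
  rw [← charFun_eq_pi_iff]
  intro t
  set y := ∑ i : Fin m, t i • u i with hy
  obtain ⟨v, hv⟩ := hGauss y
  have hv2 : (v : ℝ) = ∑ i : Fin m, t i ^ 2 * lam i := by
    rw [← integral_inner_sum_smul_sq hXmeas hXint hu heig,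
      ← integral_map (f := fun z : ℝ => z ^ 2) (hin y) (by fun_prop), hv,
      (integral_sq_gaussianReal 0 v).2]
    simp
  have h1 : charFun (Measure.map (WithLp.toLp 2)
      (Measure.map (fun ω (i : Fin m) => ⟪u i, X ω⟫) P)) t =
      charFun (Measure.map (fun ω => ⟪y, X ω⟫) P) 1 := by
    rw [AEMeasurable.map_map_of_aemeasurable (by fun_prop) hZ, charFun_apply, charFun_apply,
      integral_map (by fun_prop) (by fun_prop), integral_map (hin y) (by fun_prop)]
    refine integral_congr_ae (ae_of_all _ fun ω => ?_)
    have : ⟪y, X ω⟫ = ∑ i : Fin m, t i * ⟪u i, X ω⟫ := by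
      rw [hy, sum_inner]
      exact Finset.sum_congr rfl fun i _ => real_inner_smul_left _ _ _
    simp only [Function.comp, PiLp.inner_apply, this]
    simp [mul_comm]
  rw [h1, hv, charFun_gaussianReal]
  simp_rw [charFun_gaussianReal]
  rw [← Complex.exp_sum, hv2]
  congr 1
  simp only [Complex.ofReal_zero, mul_zero, zero_mul, zero_sub, Complex.ofReal_one, one_pow,
    mul_one, Finset.sum_neg_distrib, Real.coe_toNNReal _ (hpos _).le]
  push_cast
  rw [Finset.sum_div]
  simp [mul_comm]

end GaussianVector

theorem lintegral_exp_sq_sub_sq_gaussianReal_le {v q : ℝ≥0} (hv : v ≠ 0) (hq : q ≠ 0) (a : ℝ) :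
    ∫⁻ x, ENNReal.ofReal (rexp (x ^ 2 / (2 * max (v : ℝ) q) - (x - a) ^ 2 / (2 * q)))
      ∂(gaussianReal 0 v) ≤ ENNReal.ofReal (√(q / max (v : ℝ) q)) := by
  have hv0 : (0 : ℝ) < v := by positivity
  have hq0 : (0 : ℝ) < q := by positivity
  rcases le_total (q : ℝ) v with h | h
  · rw [max_eq_left h]
    have := lintegral_exp_quadratic_gaussianReal 0 a hv hq
    simp only [sub_zero] at this
    exact this.le
  · rw [max_eq_right h, div_self hq0.ne', Real.sqrt_one]
    have := lintegral_exp_quadratic_gaussianReal 0 (a * v / q) hv hv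
    rw [div_self hv0.ne', Real.sqrt_one] at this
    rw [← this]
    refine lintegral_mono fun x => ENNReal.ofReal_le_ofReal (Real.exp_le_exp.2 ?_)
    have e1 : (x - 0) ^ 2 / (2 * (v : ℝ)) - (x - a * v / q) ^ 2 / (2 * v) -
        (x ^ 2 / (2 * q) - (x - a) ^ 2 / (2 * q)) = a ^ 2 * (q - v) / (2 * q ^ 2) := by
      field_simp
      ring
    have : 0 ≤ a ^ 2 * ((q : ℝ) - v) / (2 * q ^ 2) :=
      div_nonneg (mul_nonneg (sq_nonneg _) (sub_nonneg.2 h)) (by positivity)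
    linarith

section Codebook

variable {H : Type*} [NormedAddCommGroup H]

theorem sInf_norm_sub_sq_le {α : Finset H} {a : H} (ha : a ∈ α) (x : H) :
    sInf ((fun a => ‖x - a‖ ^ 2) '' (α : Set H)) ≤ ‖x - a‖ ^ 2 :=
  csInf_le ⟨0, by rintro _ ⟨a, _, rfl⟩; positivity⟩
    (Set.mem_image_of_mem (fun a => ‖x - a‖ ^ 2) (Finset.mem_coe.2 ha))

theorem sInf_norm_sub_sq_nonneg (α : Finset H) (x : H) :
    0 ≤ sInf ((fun a => ‖x - a‖ ^ 2) '' (α : Set H)) :=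
  Real.sInf_nonneg (by rintro _ ⟨a, _, rfl⟩; positivity)

theorem exists_mem_norm_sub_sq_eq_sInf {α : Finset H} (hα : α.Nonempty) (x : H) :
    ∃ a ∈ α, ‖x - a‖ ^ 2 = sInf ((fun a => ‖x - a‖ ^ 2) '' (α : Set H)) := by
  obtain ⟨a, ha, h⟩ := (Set.Nonempty.image (fun a => ‖x - a‖ ^ 2) hα).csInf_mem
    (α.finite_toSet.image _)
  exact ⟨a, ha, h⟩

theorem integrable_sInf_norm_sub_sq [NormedSpace ℝ H] {Ω : Type*} [MeasurableSpace Ω]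
    {P : Measure Ω} [IsFiniteMeasure P] {X : Ω → H} (hXmeas : AEStronglyMeasurable X P)
    (hXint : Integrable (fun ω => ‖X ω‖ ^ 2) P) {α : Finset H} (hα : α.Nonempty) :
    Integrable (fun ω => sInf ((fun a => ‖X ω - a‖ ^ 2) '' (α : Set H))) P := by
  have hcont : Continuous fun x : H => sInf ((fun a => ‖x - a‖ ^ 2) '' (α : Set H)) := by
    have : (fun x : H => sInf ((fun a => ‖x - a‖ ^ 2) '' (α : Set H))) =
        fun x => α.inf' hα fun a => ‖x - a‖ ^ 2 := by
      ext x
      rw [Finset.inf'_eq_csInf_image]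
    rw [this]
    exact Continuous.finset_inf'_apply hα fun a _ => by fun_prop
  obtain ⟨a, ha⟩ := hα
  refine ((hXint.const_mul 2).add (integrable_const (2 * ‖a‖ ^ 2))).mono'
    (hcont.comp_aestronglyMeasurable hXmeas) (ae_of_all _ fun ω => ?_)
  rw [Real.norm_of_nonneg (sInf_norm_sub_sq_nonneg _ _)]
  refine (sInf_norm_sub_sq_le ha _).trans ?_
  have h1 := norm_sub_le (X ω) a
  have h2 := norm_nonneg (X ω - a)
  simp only [Pi.add_apply]
  nlinarith [sq_nonneg (‖X ω‖ - ‖a‖)]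

end Codebook

theorem Orthonormal.sum_inner_sq_le_norm_sq {H : Type*} [NormedAddCommGroup H]
    [InnerProductSpace ℝ H] {u : ℕ → H} (hu : Orthonormal ℝ u) (x : H) (M : ℕ) :
    ∑ i : Fin M, ⟪u i, x⟫ ^ 2 ≤ ‖x‖ ^ 2 := by
  have := hu.sum_inner_products_le (x := x) (s := Finset.range M)
  rw [← Fin.sum_univ_eq_sum_range (fun i => ‖⟪u i, x⟫‖ ^ 2)] at this
  simpa using this

theorem le_integral_sInf_norm_sub_sq {H : Type*} [NormedAddCommGroup H] [InnerProductSpace ℝ H]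
    {Ω : Type*} [MeasurableSpace Ω] {P : Measure Ω} [IsProbabilityMeasure P] {X : Ω → H}
    (hXmeas : AEStronglyMeasurable X P)
    (hXint : Integrable (fun ω => ‖X ω‖ ^ 2) P)
    (hGauss : ∀ y : H, ∃ v : ℝ≥0, Measure.map (fun ω => ⟪y, X ω⟫) P = gaussianReal 0 v)
    {u : ℕ → H} (hu : Orthonormal ℝ u) {lam : ℕ → ℝ} (hpos : ∀ j, 0 < lam j)
    (heig : ∀ j, ∀ y : H, ∫ ω, ⟪u j, X ω⟫ * ⟪y, X ω⟫ ∂P = lam j * ⟪u j, y⟫) (M : ℕ)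
    {θ : ℝ} (hθ : 0 < θ) {n : ℕ} {α : Finset H} (hα : α.Nonempty) (hn : α.card ≤ n) :
    ∑ i : Fin M, min (lam i) θ + θ * ∑ i : Fin M, Real.log (max (lam i) θ / θ)
      - 2 * θ * Real.log n ≤ ∫ ω, sInf ((fun a => ‖X ω - a‖ ^ 2) '' (α : Set H)) ∂P := by
  set Z : Ω → Fin M → ℝ := fun ω i => ⟪u i, X ω⟫ with hZdef
  have hZ : AEMeasurable Z P :=
    aemeasurable_pi_lambda _ fun i => AEStronglyMeasurable.aemeasurable (by fun_prop)
  have hlaw := map_inner_eq_pi_gaussianReal hXmeas hXint hGauss hu hpos heig M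
  set f : Ω → ℝ := fun ω => sInf ((fun a => ‖X ω - a‖ ^ 2) '' (α : Set H)) with hf
  have hfint : Integrable f P := integrable_sInf_norm_sub_sq hXmeas hXint hα
  set mx : Fin M → ℝ := fun i => max (lam i) θ with hmx
  have hmx0 : ∀ i, 0 < mx i := fun i => lt_max_of_lt_right hθ
  set G : Ω → ℝ := fun ω => ∑ i, Z ω i ^ 2 / (2 * mx i) with hG
  have hZ2 : ∀ i, Integrable (fun ω => Z ω i ^ 2) P := fun i => by
    simpa [sq, hZdef] using integrable_inner_mul_inner hXmeas hXint (u i) (u i)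
  have hGint : Integrable G P := integrable_finsetSum _ fun i _ => (hZ2 i).div_const _
  have hGval : ∫ ω, G ω ∂P = ∑ i : Fin M, lam i / (2 * mx i) := by
    rw [hG, integral_finsetSum _ fun i _ => (hZ2 i).div_const _]
    refine Finset.sum_congr rfl fun i _ => ?_
    rw [integral_div]
    congr 1
    have := heig i (u i)
    rw [real_inner_self_eq_norm_sq, hu.1] at this
    simpa [sq, hZdef] using this
  set F : Ω → ℝ := fun ω => G ω - f ω / (2 * θ) with hF
  have hFint : Integrable F P := hGint.sub (hfint.div_const _)
  set p : ℝ := ∏ i : Fin M, √(θ / mx i) with hp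
  have hp0 : 0 < p := Finset.prod_pos fun i _ => Real.sqrt_pos.2 (div_pos hθ (hmx0 i))
  have hle : ∫⁻ ω, ENNReal.ofReal (rexp (F ω)) ∂P ≤ ENNReal.ofReal (n * p) := by
    have hpt : ∀ ω, ENNReal.ofReal (rexp (F ω)) ≤ ∑ a ∈ α, ∏ i,
        ENNReal.ofReal (rexp (Z ω i ^ 2 / (2 * mx i) - (Z ω i - ⟪u i, a⟫) ^ 2 / (2 * θ))) := by
      intro ω
      obtain ⟨a, ha, hfa⟩ := exists_mem_norm_sub_sq_eq_sInf hα (X ω)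
      refine le_trans ?_ (Finset.single_le_sum (fun _ _ => zero_le) ha)
      rw [← ENNReal.ofReal_prod_of_nonneg fun i _ => (Real.exp_pos _).le, ← Real.exp_sum]
      refine ENNReal.ofReal_le_ofReal (Real.exp_le_exp.2 ?_)
      rw [Finset.sum_sub_distrib, ← Finset.sum_div]
      simp only [hF, hf]
      rw [← hfa]
      gcongr
      have := hu.sum_inner_sq_le_norm_sq (X ω - a) M
      simpa only [inner_sub_right] using this
    have hint : ∀ a : H, ∫⁻ ω, ∏ i,
        ENNReal.ofReal (rexp (Z ω i ^ 2 / (2 * mx i) - (Z ω i - ⟪u i, a⟫) ^ 2 / (2 * θ))) ∂P ≤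
        ENNReal.ofReal p := by
      intro a
      rw [← lintegral_map' (f := fun z : Fin M → ℝ => ∏ i,
        ENNReal.ofReal (rexp (z i ^ 2 / (2 * mx i) - (z i - ⟪u i, a⟫) ^ 2 / (2 * θ))))
        (by fun_prop) hZ, hlaw, lintegral_pi_prod _ (fun i x => ENNReal.ofReal
          (rexp (x ^ 2 / (2 * mx i) - (x - ⟪u i, a⟫) ^ 2 / (2 * θ)))) fun i => by fun_prop]
      · rw [hp, ENNReal.ofReal_prod_of_nonneg fun i _ => Real.sqrt_nonneg _]
        refine Finset.prod_le_prod' fun i _ => ?_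
        have := lintegral_exp_sq_sub_sq_gaussianReal_le (v := (lam i).toNNReal)
          (q := θ.toNNReal) (by simpa using hpos i) (by simpa using hθ) ⟪u i, a⟫
        rwa [Real.coe_toNNReal _ (hpos i).le, Real.coe_toNNReal _ hθ.le] at this
    calc _ ≤ ∫⁻ ω, ∑ a ∈ α, ∏ i, ENNReal.ofReal
          (rexp (Z ω i ^ 2 / (2 * mx i) - (Z ω i - ⟪u i, a⟫) ^ 2 / (2 * θ))) ∂P :=
          lintegral_mono hpt
      _ = ∑ a ∈ α, ∫⁻ ω, ∏ i, ENNReal.ofReal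
          (rexp (Z ω i ^ 2 / (2 * mx i) - (Z ω i - ⟪u i, a⟫) ^ 2 / (2 * θ))) ∂P :=
          lintegral_finsetSum' _ fun a _ => by
            exact (by fun_prop : Measurable fun z : Fin M → ℝ => ∏ i, ENNReal.ofReal
              (rexp (z i ^ 2 / (2 * mx i) - (z i - ⟪u i, a⟫) ^ 2 / (2 * θ)))).comp_aemeasurable hZ
      _ ≤ ∑ a ∈ α, ENNReal.ofReal p := Finset.sum_le_sum fun a _ => hint a
      _ = ENNReal.ofReal (α.card * p) := by
          rw [Finset.sum_const, nsmul_eq_mul, ENNReal.ofReal_mul (by positivity),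
            ENNReal.ofReal_natCast]
      _ ≤ _ := by gcongr
  have hexpint : Integrable (fun ω => rexp (F ω)) P := by
    refine ⟨(Real.continuous_exp.comp_aestronglyMeasurable hFint.1), ?_⟩
    rw [hasFiniteIntegral_iff_ofReal (ae_of_all _ fun ω => (Real.exp_pos _).le)]
    exact hle.trans_lt ENNReal.ofReal_lt_top
  have hjen : rexp (∫ ω, F ω ∂P) ≤ n * p := by
    calc rexp (∫ ω, F ω ∂P) ≤ ∫ ω, rexp (F ω) ∂P :=
          convexOn_exp.map_integral_le Real.continuous_exp.continuousOn isClosed_univ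
            (by simp) hFint hexpint
      _ ≤ _ := by
          rw [integral_eq_lintegral_of_nonneg_ae (ae_of_all _ fun ω => (Real.exp_pos _).le)
            hexpint.1]
          exact ENNReal.toReal_le_of_le_ofReal (by positivity) hle
  have hn0 : (0 : ℝ) < n := by
    exact_mod_cast (Finset.card_pos.2 hα).trans_le hn
  rw [← Real.le_log_iff_exp_le (by positivity), Real.log_mul hn0.ne' hp0.ne', hF,
    integral_sub hGint (hfint.div_const _), hGval, integral_div, hp,
    Real.log_prod fun i _ => (Real.sqrt_pos.2 (div_pos hθ (hmx0 i))).ne'] at hjen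
  have hs : ∑ i, Real.log √(θ / mx i) = - (∑ i, Real.log (mx i / θ)) / 2 := by
    rw [← Finset.sum_neg_distrib, Finset.sum_div]
    refine Finset.sum_congr rfl fun i _ => ?_
    rw [Real.log_sqrt (div_pos hθ (hmx0 i)).le, ← Real.log_inv, inv_div]
  have hm : ∑ i : Fin M, min (lam i) θ = 2 * θ * ∑ i : Fin M, lam i / (2 * mx i) := by
    rw [Finset.mul_sum]
    refine Finset.sum_congr rfl fun i _ => ?_
    have h1 := min_mul_max (lam i) θ
    have h2 := hmx0 i
    rw [← eq_div_iff h2.ne'] at h1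
    rw [h1]
    field_simp
  rw [hs] at hjen
  rw [hm]
  have h3 := mul_le_mul_of_nonneg_left hjen (by positivity : 0 ≤ 2 * θ)
  have h4 : 2 * θ * (∑ i : Fin M, lam i / (2 * mx i) - (∫ ω, f ω ∂P) / (2 * θ)) =
      2 * θ * ∑ i : Fin M, lam i / (2 * mx i) - ∫ ω, f ω ∂P := by
    field_simp
  rw [h4] at h3
  change _ ≤ ∫ ω, f ω ∂P
  linarith

section QuantErr

variable {H : Type*} [NormedAddCommGroup H] [InnerProductSpace ℝ H]
  {Ω : Type*} [MeasurableSpace Ω] {P : Measure Ω} {X : Ω → H}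

theorem quantErr_nonneg (n : ℕ) : 0 ≤ quantErr P X n := by
  refine Real.sInf_nonneg ?_
  rintro _ ⟨α, -, -, rfl⟩
  exact Real.rpow_nonneg (integral_nonneg fun ω => sInf_norm_sub_sq_nonneg _ _) _

theorem quantErr_sq_le_integral {n : ℕ} {α : Finset H} (hα : α.Nonempty) (hn : α.card ≤ n) :
    quantErr P X n ^ 2 ≤ ∫ ω, sInf ((fun a => ‖X ω - a‖ ^ 2) '' (α : Set H)) ∂P := by
  have h0 : 0 ≤ ∫ ω, sInf ((fun a => ‖X ω - a‖ ^ 2) '' (α : Set H)) ∂P :=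
    integral_nonneg fun ω => sInf_norm_sub_sq_nonneg _ _
  have h1 : quantErr P X n ≤ √(∫ ω, sInf ((fun a => ‖X ω - a‖ ^ 2) '' (α : Set H)) ∂P) := by
    rw [Real.sqrt_eq_rpow]
    refine csInf_le ⟨0, ?_⟩ ⟨α, hα, hn, rfl⟩
    rintro _ ⟨β, -, -, rfl⟩
    exact Real.rpow_nonneg (integral_nonneg fun ω => sInf_norm_sub_sq_nonneg _ _) _
  exact (Real.le_sqrt (quantErr_nonneg n) h0).1 h1

theorem le_quantErr_sq {n : ℕ} (hn : 1 ≤ n) {c : ℝ}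
    (h : ∀ α : Finset H, α.Nonempty → α.card ≤ n →
      c ≤ ∫ ω, sInf ((fun a => ‖X ω - a‖ ^ 2) '' (α : Set H)) ∂P) :
    c ≤ quantErr P X n ^ 2 := by
  have h1 : √c ≤ quantErr P X n := by
    refine le_csInf ⟨_, {0}, Finset.singleton_nonempty _, by simpa using hn, rfl⟩ ?_
    rintro _ ⟨α, hα, hαn, rfl⟩
    rw [← Real.sqrt_eq_rpow]
    exact Real.sqrt_le_sqrt (h α hα hαn)
  exact (Real.sqrt_le_left (quantErr_nonneg n)).1 h1

theorem le_quantErr_sq_of_summable [IsProbabilityMeasure P]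
    (hXmeas : AEStronglyMeasurable X P)
    (hXint : Integrable (fun ω => ‖X ω‖ ^ 2) P)
    (hGauss : ∀ y : H, ∃ v : ℝ≥0, Measure.map (fun ω => ⟪y, X ω⟫) P = gaussianReal 0 v)
    {u : ℕ → H} (hu : Orthonormal ℝ u) {lam : ℕ → ℝ} (hpos : ∀ j, 0 < lam j)
    (hanti : Antitone lam) (hsum : Summable lam)
    (heig : ∀ j, ∀ y : H, ∫ ω, ⟪u j, X ω⟫ * ⟪y, X ω⟫ ∂P = lam j * ⟪u j, y⟫) (m : ℕ)
    {n : ℕ} (hn : 1 ≤ n) :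
    m * lam m + ∑' j, lam (j + m) + lam m * (∑ j ∈ Finset.range m, Real.log (lam j / lam m)
      - 2 * Real.log n) ≤ quantErr P X n ^ 2 := by
  refine le_quantErr_sq hn fun α hα hαn => ?_
  set I := ∫ ω, sInf ((fun a => ‖X ω - a‖ ^ 2) '' (α : Set H)) ∂P
  have hlim : Tendsto (fun k => m * lam m + ∑ j ∈ Finset.range k, lam (j + m) +
      lam m * (∑ j ∈ Finset.range m, Real.log (lam j / lam m) - 2 * Real.log n)) atTop
      (nhds (m * lam m + ∑' j, lam (j + m) + lam m *
        (∑ j ∈ Finset.range m, Real.log (lam j / lam m) - 2 * Real.log n))) :=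
    (((summable_nat_add_iff m).2 hsum).hasSum.tendsto_sum_nat.const_add _).add_const _
  refine le_of_tendsto' hlim fun k => ?_
  have h := le_integral_sInf_norm_sub_sq hXmeas hXint hGauss hu hpos heig (m + k) (hpos m) hα hαn
  rw [Fin.sum_univ_eq_sum_range (fun i => min (lam i) (lam m)),
    Fin.sum_univ_eq_sum_range (fun i => Real.log (max (lam i) (lam m) / lam m)),
    Finset.sum_range_add, Finset.sum_range_add] at h
  have h1 : ∑ i ∈ Finset.range m, min (lam i) (lam m) = m * lam m := by
    rw [Finset.sum_congr rfl fun i hi => min_eq_right (hanti (Finset.mem_range.1 hi).le)]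
    simp
  have h2 : ∑ i ∈ Finset.range k, min (lam (m + i)) (lam m) = ∑ j ∈ Finset.range k, lam (j + m) :=
    Finset.sum_congr rfl fun i _ => by
      rw [min_eq_left (hanti (Nat.le_add_right _ _)), add_comm]
  have h3 : ∑ i ∈ Finset.range m, Real.log (max (lam i) (lam m) / lam m) =
      ∑ i ∈ Finset.range m, Real.log (lam i / lam m) :=
    Finset.sum_congr rfl fun i hi => by
      rw [max_eq_left (hanti (Finset.mem_range.1 hi).le)]
  have h4 : ∑ i ∈ Finset.range k, Real.log (max (lam (m + i)) (lam m) / lam m) = 0 :=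
    Finset.sum_eq_zero fun i _ => by
      rw [max_eq_right (hanti (Nat.le_add_right _ _)), div_self (hpos m).ne', Real.log_one]
  rw [h1, h2, h3, h4] at h
  linarith

end QuantErr

section Upper

variable {H : Type*} [NormedAddCommGroup H] [InnerProductSpace ℝ H]
  {Ω : Type*} [MeasurableSpace Ω] {P : Measure Ω} {X : Ω → H}

theorem integral_indicator_energy_le [IsProbabilityMeasure P] (hXmeas : AEStronglyMeasurable X P)
    (hXint : Integrable (fun ω => ‖X ω‖ ^ 2) P)
    (hGauss : ∀ y : H, ∃ v : ℝ≥0, Measure.map (fun ω => ⟪y, X ω⟫) P = gaussianReal 0 v)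
    {u : ℕ → H} (hu : Orthonormal ℝ u) {lam : ℕ → ℝ} (hpos : ∀ j, 0 < lam j)
    (heig : ∀ j, ∀ y : H, ∫ ω, ⟪u j, X ω⟫ * ⟪y, X ω⟫ ∂P = lam j * ⟪u j, y⟫) (m : ℕ)
    {ε : ℝ} (hε : 0 < ε) (hε1 : ε ≤ 1) :
    Integrable ({x : ℝ | m * (1 + ε) < x}.indicator id ∘
      fun ω => ∑ i : Fin m, ⟪u i, X ω⟫ ^ 2 / lam i) P ∧
    ∫ ω, {x : ℝ | m * (1 + ε) < x}.indicator id (∑ i : Fin m, ⟪u i, X ω⟫ ^ 2 / lam i) ∂P ≤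
      128 / ε ^ 2 * rexp (-(ε ^ 2 / 64 * m)) := by
  set Z : Ω → Fin m → ℝ := fun ω i => ⟪u i, X ω⟫ with hZdef
  have hZ : AEMeasurable Z P :=
    aemeasurable_pi_lambda _ fun i => AEStronglyMeasurable.aemeasurable (by fun_prop)
  have hlaw := map_inner_eq_pi_gaussianReal hXmeas hXint hGauss hu hpos heig m
  set ind : ℝ → ℝ := {x : ℝ | m * (1 + ε) < x}.indicator id with hind
  have hindm : Measurable ind := measurable_id.indicator measurableSet_Ioi
  set S : (Fin m → ℝ) → ℝ := fun z => ∑ i, z i ^ 2 / lam i with hS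
  have hS0 : ∀ z, 0 ≤ S z := fun z => Finset.sum_nonneg fun i _ =>
    div_nonneg (sq_nonneg _) (hpos i).le
  have hSm : Measurable S := by fun_prop
  have hi0 : ∀ z, 0 ≤ ind (S z) := fun z => Set.indicator_apply_nonneg fun _ => hS0 z
  set t := ε / 32 with ht
  set η := t * ε / 4 with hη
  have ht0 : 0 < t := by positivity
  have hη0 : 0 < η := by positivity
  set τ := t + η with hτ
  have hτ0 : 0 < τ := by positivity
  have hτ4 : τ * 1 ≤ 1 / 4 := by rw [hτ, hη, ht]; nlinarith
  have hpt : ∀ z, ENNReal.ofReal (ind (S z)) ≤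
      ENNReal.ofReal (1 / η * rexp (-(t * (m * (1 + ε))))) *
        ∏ i : Fin m, ENNReal.ofReal (rexp (τ / lam i * z i ^ 2)) := by
    intro z
    rw [← ENNReal.ofReal_prod_of_nonneg fun i _ => (Real.exp_pos _).le, ← Real.exp_sum,
      ← ENNReal.ofReal_mul (by positivity)]
    refine ENNReal.ofReal_le_ofReal ?_
    have hsum : ∑ i : Fin m, τ / lam i * z i ^ 2 = τ * S z := by
      rw [hS, Finset.mul_sum]
      exact Finset.sum_congr rfl fun i _ => by ring
    rw [hsum]
    refine Set.indicator_apply_le' (fun h => ?_) (fun _ => by positivity)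
    have h1 : η * S z ≤ rexp (η * S z) := by linarith [Real.add_one_le_exp (η * S z)]
    have h2 : 1 ≤ rexp (t * (S z - m * (1 + ε))) :=
      Real.one_le_exp (mul_nonneg ht0.le (sub_nonneg.2 (le_of_lt h)))
    calc S z = 1 / η * (η * S z * 1) := by field_simp
      _ ≤ 1 / η * (rexp (η * S z) * rexp (t * (S z - m * (1 + ε)))) := by
          have := hS0 z
          gcongr
      _ = _ := by
          rw [← Real.exp_add, mul_assoc, ← Real.exp_add, hτ]
          ring_nf
  have hle : ∫⁻ ω, ENNReal.ofReal (ind (S (Z ω))) ∂P ≤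
      ENNReal.ofReal (128 / ε ^ 2 * rexp (-(ε ^ 2 / 64 * m))) := by
    rw [← lintegral_map' (f := fun z : Fin m → ℝ => ENNReal.ofReal (ind (S z)))
        (by fun_prop) hZ, hlaw]
    refine (lintegral_mono hpt).trans ?_
    rw [lintegral_const_mul _ (by fun_prop), lintegral_pi_prod _ (fun (i : Fin m) x => ENNReal.ofReal
      (rexp (τ / lam i * x ^ 2))) fun i => by fun_prop]
    have hprod : ∏ i : Fin m, ∫⁻ x, ENNReal.ofReal (rexp (τ / lam i * x ^ 2))
        ∂(gaussianReal 0 (lam i).toNNReal) ≤ ENNReal.ofReal (rexp (m * (τ * (1 + 4 * τ)))) := by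
      rw [Real.exp_nat_mul, ENNReal.ofReal_pow (Real.exp_pos _).le]
      have : ∀ i : Fin m, ∫⁻ x, ENNReal.ofReal (rexp (τ / lam i * x ^ 2))
          ∂(gaussianReal 0 (lam i).toNNReal) ≤ ENNReal.ofReal (rexp (τ * (1 + 4 * τ))) := by
        intro i
        have hl := (hpos i).ne'
        have hc := Real.coe_toNNReal _ (hpos i).le
        have := lintegral_exp_mul_sq_gaussianReal_le 0 (q := (lam i).toNNReal)
          (by simpa using hpos i) (t := τ / lam i) (div_nonneg hτ0.le (hpos i).le) (Q := lam i)
          hc.le (by rw [div_mul_cancel₀ _ hl]; linarith)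
        refine this.trans_eq ?_
        rw [hc]
        congr 2
        field_simp
        ring
      refine (Finset.prod_le_prod' fun i _ => this i).trans_eq ?_
      rw [Finset.prod_const, Finset.card_univ, Fintype.card_fin]
    refine (mul_le_mul_right hprod _).trans ?_
    rw [← ENNReal.ofReal_mul (by positivity)]
    refine ENNReal.ofReal_le_ofReal ?_
    rw [mul_assoc, ← Real.exp_add]
    have e1 : 1 / η = 128 / ε ^ 2 := by rw [hη, ht]; field_simp; norm_num
    rw [e1]
    refine mul_le_mul_of_nonneg_left (Real.exp_le_exp.2 ?_) (by positivity)
    have e2 : τ * (1 + 4 * τ) - t * (1 + ε) ≤ -(ε ^ 2 / 64) := by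
      have e3 : τ = t * (1 + ε / 4) := by rw [hτ, hη]; ring
      have e4 : 4 * τ ≤ 5 * ε / 32 := by rw [e3, ht]; nlinarith
      have e5 : τ * (1 + 4 * τ) ≤ t * ((1 + ε / 4) * (1 + 5 * ε / 32)) := by
        calc τ * (1 + 4 * τ) ≤ τ * (1 + 5 * ε / 32) := by gcongr
          _ = _ := by rw [e3]; ring
      have e6 : (1 + ε / 4) * (1 + 5 * ε / 32) ≤ 1 + ε / 2 := by nlinarith
      have e7 := mul_le_mul_of_nonneg_left e6 ht0.le
      have e8 : t * (1 + ε / 2) - t * (1 + ε) = -(ε ^ 2 / 64) := by rw [ht]; ring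
      linarith
    have := mul_le_mul_of_nonneg_left e2 (Nat.cast_nonneg (α := ℝ) m)
    linarith
  have hint : Integrable (fun ω => ind (S (Z ω))) P := by
    refine ⟨((hindm.comp hSm).comp_aemeasurable hZ).aestronglyMeasurable, ?_⟩
    rw [hasFiniteIntegral_iff_ofReal (ae_of_all _ fun ω => hi0 _)]
    exact hle.trans_lt ENNReal.ofReal_lt_top
  refine ⟨hint, ?_⟩
  rw [integral_eq_lintegral_of_nonneg_ae (ae_of_all _ fun ω => hi0 _) hint.1]
  exact ENNReal.toReal_le_of_le_ofReal (by positivity) hle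

theorem integral_norm_sub_sum_inner_sq [CompleteSpace H]
    (hXmeas : AEStronglyMeasurable X P) (hXint : Integrable (fun ω => ‖X ω‖ ^ 2) P)
    {u : ℕ → H} (hu : Orthonormal ℝ u) {lam : ℕ → ℝ} (hsum : Summable lam)
    (heig : ∀ j, ∀ y : H, ∫ ω, ⟪u j, X ω⟫ * ⟪y, X ω⟫ ∂P = lam j * ⟪u j, y⟫)
    (hspan : ∀ᵐ ω ∂P, X ω ∈ closure (Submodule.span ℝ (Set.range u) : Set H)) (m : ℕ) :
    Integrable (fun ω => ∑' j, ⟪X ω, u (j + m)⟫ ^ 2) P ∧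
      ∫ ω, ∑' j, ⟪X ω, u (j + m)⟫ ^ 2 ∂P = ∑' j, lam (j + m) := by
  have hsq : ∀ ω j, ⟪X ω, u j⟫ ^ 2 = ⟪u j, X ω⟫ * ⟪u j, X ω⟫ := fun ω j => by
    rw [real_inner_comm, sq]
  have hint : ∀ j, Integrable (fun ω => ⟪X ω, u j⟫ ^ 2) P := fun j => by
    simp_rw [hsq]
    exact integrable_inner_mul_inner hXmeas hXint _ _
  have hval : ∀ j, ∫ ω, ⟪X ω, u j⟫ ^ 2 ∂P = lam j := fun j => by
    simp_rw [hsq]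
    rw [heig, real_inner_self_eq_norm_sq, hu.1]
    simp
  constructor
  · have h1 : Integrable (fun ω => ‖X ω‖ ^ 2 - ∑ i : Fin m, ⟪X ω, u i⟫ ^ 2) P :=
      hXint.sub (integrable_finsetSum _ fun i _ => hint i)
    refine h1.congr ?_
    filter_upwards [hspan] with ω hω
    have := hu.norm_sub_sum_sq hω (m := m) (fun _ => 0)
    simp only [zero_smul, Finset.sum_const_zero, sub_zero] at this
    rw [this]
    ring
  · rw [← integral_tsum_of_summable_integral_norm (fun j => hint (j + m))]
    · simp_rw [hval]
    · simp only [norm_pow, Real.norm_eq_abs, sq_abs, hval]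
      exact (summable_nat_add_iff m).2 hsum

end Upper

section Relation

variable {H : Type*} [NormedAddCommGroup H] [InnerProductSpace ℝ H] {u : ℕ → H} {lam : ℕ → ℝ}

theorem sum_smul_mem_ellipsoid (hu : Orthonormal ℝ u) {m : ℕ} {d : ℕ → ℝ}
    (hd : ∑ j ∈ Finset.range m, d j ^ 2 / lam j ≤ 1) :
    ∑ j ∈ Finset.range m, d j • u j ∈ {x ∈ closure (Submodule.span ℝ (Set.range u) : Set H) |
        Summable (fun j => ⟪x, u j⟫ ^ 2 / lam j) ∧ ∑' j, ⟪x, u j⟫ ^ 2 / lam j ≤ 1} := by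
  have hin : ∀ j ∈ Finset.range m, ⟪∑ j ∈ Finset.range m, d j • u j, u j⟫ = d j := fun j hj => by
    simpa using hu.inner_left_sum d hj
  have hout : ∀ j ∉ Finset.range m, ⟪∑ j ∈ Finset.range m, d j • u j, u j⟫ ^ 2 / lam j = 0 := by
    intro j hj
    rw [sum_inner, Finset.sum_eq_zero, zero_pow two_ne_zero, zero_div]
    intro i hi
    rw [real_inner_smul_left, hu.2 (ne_of_mem_of_not_mem hi hj), mul_zero]
  refine ⟨subset_closure (Submodule.sum_mem _ fun i _ =>
    Submodule.smul_mem _ _ (Submodule.subset_span ⟨i, rfl⟩)),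
    summable_of_ne_finset_zero hout, ?_⟩
  rw [tsum_eq_sum hout]
  refine le_trans (le_of_eq (Finset.sum_congr rfl fun j hj => ?_)) hd
  rw [hin j hj]

theorem norm_sq_le_of_mem_ellipsoid [CompleteSpace H] (hu : Orthonormal ℝ u)
    (hpos : ∀ j, 0 < lam j) (hanti : Antitone lam) {x : H}
    (hx : x ∈ {x ∈ closure (Submodule.span ℝ (Set.range u) : Set H) |
        Summable (fun j => ⟪x, u j⟫ ^ 2 / lam j) ∧ ∑' j, ⟪x, u j⟫ ^ 2 / lam j ≤ 1}) :
    ‖x‖ ^ 2 ≤ lam 0 := by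
  obtain ⟨hx, hs, h1⟩ := hx
  have h := hu.hasSum_inner_sq_of_mem_closure_span hx
  rw [← h.tsum_eq]
  calc ∑' j, ⟪x, u j⟫ ^ 2 ≤ ∑' j, lam 0 * (⟪x, u j⟫ ^ 2 / lam j) := by
        refine h.summable.tsum_le_tsum (fun j => ?_) (hs.mul_left _)
        rw [mul_div_left_comm]
        exact le_mul_of_one_le_right (sq_nonneg _) ((one_le_div (hpos j)).2 (hanti (Nat.zero_le j)))
    _ ≤ lam 0 := by
        rw [tsum_mul_left]
        exact mul_le_of_le_one_right (hpos 0).le h1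

/-- A covering of the ellipsoid, scaled and projected, serves as a codebook for points whose
energy in the first `m` coordinates is at most `ρ`. -/
theorem exists_norm_sub_smul_sum_sq_le [CompleteSpace H] (hu : Orthonormal ℝ u)
    (hpos : ∀ j, 0 < lam j) (hanti : Antitone lam) {α : Finset H} {r ρ : ℝ} (hρ : 0 < ρ)
    (hα : ∀ x ∈ {x ∈ closure (Submodule.span ℝ (Set.range u) : Set H) |
        Summable (fun j => ⟪x, u j⟫ ^ 2 / lam j) ∧ ∑' j, ⟪x, u j⟫ ^ 2 / lam j ≤ 1},
      ∃ a ∈ α, ‖x - a‖ < r) {x : H} (hx : x ∈ closure (Submodule.span ℝ (Set.range u) : Set H))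
    (m : ℕ) :
    ∃ a ∈ α, ‖x - ∑ i : Fin m, (√ρ * ⟪a, u i⟫) • u i‖ ^ 2 ≤
      ρ * r ^ 2 + (2 * lam 0 + 2 * r ^ 2) * {x : ℝ | ρ < x}.indicator id
        (∑ i : Fin m, ⟪u i, x⟫ ^ 2 / lam i) + ∑' j, ⟪x, u (j + m)⟫ ^ 2 := by
  set S := ∑ i : Fin m, ⟪u i, x⟫ ^ 2 / lam i with hS
  have hsq : ∀ y : H, ∑ i : Fin m, ⟪y, u i⟫ ^ 2 ≤ ‖y‖ ^ 2 := fun y => by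
    simpa only [real_inner_comm] using hu.sum_inner_sq_le_norm_sq y m
  rcases le_or_gt S ρ with h | h
  · rw [Set.indicator_of_notMem (by simpa using h), mul_zero, add_zero]
    set y := ∑ j ∈ Finset.range m, (⟪x, u j⟫ / √ρ) • u j with hy
    obtain ⟨a, ha, hya⟩ := hα y (sum_smul_mem_ellipsoid hu (by
      rw [← Fin.sum_univ_eq_sum_range (fun j => (⟪x, u j⟫ / √ρ) ^ 2 / lam j)]
      calc ∑ i : Fin m, (⟪x, u i⟫ / √ρ) ^ 2 / lam i = S / ρ := by
            rw [hS, Finset.sum_div]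
            refine Finset.sum_congr rfl fun i _ => ?_
            rw [div_pow, Real.sq_sqrt hρ.le, real_inner_comm]
            ring
        _ ≤ 1 := (div_le_one hρ).2 h))
    refine ⟨a, ha, ?_⟩
    rw [hu.norm_sub_sum_sq hx]
    have hin : ∀ i : Fin m, ⟪y, u i⟫ = ⟪x, u i⟫ / √ρ := fun i => by
      simpa using hu.inner_left_sum (fun j => ⟪x, u j⟫ / √ρ) (Finset.mem_range.2 i.2)
    have hs0 : √ρ ≠ 0 := (Real.sqrt_pos.2 hρ).ne'
    have : ∑ i : Fin m, (⟪x, u i⟫ - √ρ * ⟪a, u i⟫) ^ 2 = ρ * ∑ i : Fin m, ⟪y - a, u i⟫ ^ 2 := by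
      rw [Finset.mul_sum]
      refine Finset.sum_congr rfl fun i _ => ?_
      rw [inner_sub_left, hin]
      nth_rewrite 2 [← Real.sq_sqrt hρ.le]
      field_simp
    rw [this]
    have h2 : ‖y - a‖ ^ 2 ≤ r ^ 2 := by gcongr
    have := mul_le_mul_of_nonneg_left ((hsq (y - a)).trans h2) hρ.le
    linarith
  · rw [Set.indicator_of_mem (by simpa using h)]
    obtain ⟨a, ha, h0a⟩ := hα 0 (by
      simpa using sum_smul_mem_ellipsoid (lam := lam) hu (m := 0) (d := 0) (by simp))
    rw [zero_sub, norm_neg] at h0a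
    refine ⟨a, ha, ?_⟩
    rw [hu.norm_sub_sum_sq hx, id]
    have h1 : ∑ i : Fin m, ⟪x, u i⟫ ^ 2 ≤ lam 0 * S := by
      rw [hS, Finset.mul_sum]
      refine Finset.sum_le_sum fun i _ => ?_
      rw [mul_div_left_comm, real_inner_comm]
      exact le_mul_of_one_le_right (sq_nonneg _)
        ((one_le_div (hpos i)).2 (hanti (Nat.zero_le _)))
    have h2 : ρ * ∑ i : Fin m, ⟪a, u i⟫ ^ 2 ≤ S * r ^ 2 := by
      have : ‖a‖ ^ 2 ≤ r ^ 2 := by gcongr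
      exact mul_le_mul h.le ((hsq a).trans this) (Finset.sum_nonneg fun i _ => sq_nonneg _)
        (hρ.trans h).le
    have h3 : ∑ i : Fin m, (⟪x, u i⟫ - √ρ * ⟪a, u i⟫) ^ 2 ≤
        2 * ∑ i : Fin m, ⟪x, u i⟫ ^ 2 + 2 * (ρ * ∑ i : Fin m, ⟪a, u i⟫ ^ 2) := by
      simp only [Finset.mul_sum, ← Finset.sum_add_distrib]
      refine Finset.sum_le_sum fun i _ => ?_
      have := Real.sq_sqrt hρ.le
      have h4 := sq_nonneg (⟪x, u i⟫ + √ρ * ⟪a, u i⟫)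
      have : (√ρ * ⟪a, u i⟫) ^ 2 = ρ * ⟪a, u i⟫ ^ 2 := by rw [mul_pow, this]
      nlinarith
    have : 0 ≤ ρ * r ^ 2 := by positivity
    linarith

theorem quantErr_sq_le_entropyNum_sq [CompleteSpace H]
    {Ω : Type*} [MeasurableSpace Ω] {P : Measure Ω} [IsProbabilityMeasure P] {X : Ω → H}
    (hXmeas : AEStronglyMeasurable X P) (hXint : Integrable (fun ω => ‖X ω‖ ^ 2) P)
    (hGauss : ∀ y : H, ∃ v : ℝ≥0, Measure.map (fun ω => ⟪y, X ω⟫) P = gaussianReal 0 v)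
    (hu : Orthonormal ℝ u) (hpos : ∀ j, 0 < lam j) (hanti : Antitone lam) (hsum : Summable lam)
    (heig : ∀ j, ∀ y : H, ∫ ω, ⟪u j, X ω⟫ * ⟪y, X ω⟫ ∂P = lam j * ⟪u j, y⟫)
    (hspan : ∀ᵐ ω ∂P, X ω ∈ closure (Submodule.span ℝ (Set.range u) : Set H))
    {n : ℕ} (hn : 1 ≤ n) {m : ℕ} (hm : 1 ≤ m) {ε : ℝ} (hε : 0 < ε) (hε1 : ε ≤ 1) :
    quantErr P X n ^ 2 ≤
      m * (1 + ε) * entropyNum {x ∈ closure (Submodule.span ℝ (Set.range u) : Set H) |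
        Summable (fun j => ⟪x, u j⟫ ^ 2 / lam j) ∧ ∑' j, ⟪x, u j⟫ ^ 2 / lam j ≤ 1} n ^ 2 +
      4 * lam 0 * (128 / ε ^ 2 * rexp (-(ε ^ 2 / 64 * m))) + ∑' j, lam (j + m) := by
  classical
  set U := {x ∈ closure (Submodule.span ℝ (Set.range u) : Set H) |
        Summable (fun j => ⟪x, u j⟫ ^ 2 / lam j) ∧ ∑' j, ⟪x, u j⟫ ^ 2 / lam j ≤ 1} with hU
  have hUn : ∀ x ∈ U, ‖x‖ ≤ √(lam 0) := fun x hx =>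
    Real.le_sqrt_of_sq_le (norm_sq_le_of_mem_ellipsoid hu hpos hanti hx)
  obtain ⟨hi1, hb1⟩ := integral_indicator_energy_le hXmeas hXint hGauss hu hpos heig m hε hε1
  obtain ⟨hi2, hb2⟩ := integral_norm_sub_sum_inner_sq hXmeas hXint hu hsum heig hspan m
  set ρ : ℝ := m * (1 + ε) with hρdef
  have hρ : 0 < ρ := by positivity
  set E := 128 / ε ^ 2 * rexp (-(ε ^ 2 / 64 * m)) with hE
  have hE0 : 0 ≤ E := by positivity
  have key : ∀ r, entropyNum U n < r →
      quantErr P X n ^ 2 ≤ ρ * r ^ 2 + (2 * lam 0 + 2 * r ^ 2) * E + ∑' j, lam (j + m) := by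
    intro r hr
    obtain ⟨α, hα, hαn, hcov⟩ := exists_cover_of_entropyNum_lt hn hUn hr
    set g : H → H := fun a => ∑ i : Fin m, (√ρ * ⟪a, u i⟫) • u i with hg
    have hβ : (α.image g).Nonempty := hα.image g
    refine (quantErr_sq_le_integral hβ (Finset.card_image_le.trans hαn)).trans ?_
    calc ∫ ω, sInf ((fun a => ‖X ω - a‖ ^ 2) '' (α.image g : Set H)) ∂P
        ≤ ∫ ω, (ρ * r ^ 2 + (2 * lam 0 + 2 * r ^ 2) * {x : ℝ | ρ < x}.indicator id
          (∑ i : Fin m, ⟪u i, X ω⟫ ^ 2 / lam i) + ∑' j, ⟪X ω, u (j + m)⟫ ^ 2) ∂P := by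
          refine integral_mono_ae (integrable_sInf_norm_sub_sq hXmeas hXint hβ)
            (((integrable_const _).add (hi1.const_mul _)).add hi2) ?_
          filter_upwards [hspan] with ω hω
          obtain ⟨a, ha, h⟩ := exists_norm_sub_smul_sum_sq_le hu hpos hanti hρ hcov hω m
          exact (sInf_norm_sub_sq_le (Finset.mem_image_of_mem g ha) _).trans h
      _ = ρ * r ^ 2 + (2 * lam 0 + 2 * r ^ 2) * (∫ ω, {x : ℝ | ρ < x}.indicator id
          (∑ i : Fin m, ⟪u i, X ω⟫ ^ 2 / lam i) ∂P) + ∑' j, lam (j + m) := by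
          have hi3 : Integrable (fun ω => (2 * lam 0 + 2 * r ^ 2) * {x : ℝ | ρ < x}.indicator id
              (∑ i : Fin m, ⟪u i, X ω⟫ ^ 2 / lam i)) P := hi1.const_mul _
          have hi4 : Integrable (fun ω => ρ * r ^ 2 + (2 * lam 0 + 2 * r ^ 2) *
              {x : ℝ | ρ < x}.indicator id (∑ i : Fin m, ⟪u i, X ω⟫ ^ 2 / lam i)) P :=
            (integrable_const _).add hi3
          rw [integral_add hi4 hi2, hb2, integral_add (integrable_const _) hi3,
            integral_const, integral_const_mul (2 * lam 0 + 2 * r ^ 2)]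
          simp
      _ ≤ _ := by
          have := (hpos 0).le
          gcongr
  have hlim : quantErr P X n ^ 2 ≤ ρ * entropyNum U n ^ 2 +
      (2 * lam 0 + 2 * entropyNum U n ^ 2) * E + ∑' j, lam (j + m) := by
    have hc : Continuous fun r : ℝ =>
        ρ * r ^ 2 + (2 * lam 0 + 2 * r ^ 2) * E + ∑' j, lam (j + m) := by fun_prop
    exact ge_of_tendsto (hc.continuousWithinAt (s := Set.Ioi (entropyNum U n)))
      (eventually_mem_nhdsWithin.mono fun r hr => key r hr)
  have he : entropyNum U n ^ 2 ≤ lam 0 := by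
    have := entropyNum_le (K := U) (n := n) (Finset.singleton_nonempty 0) (by simpa using hn)
      (Real.sqrt_nonneg (lam 0)) fun x hx => ⟨0, by simp, by simpa using hUn x hx⟩
    calc entropyNum U n ^ 2 ≤ √(lam 0) ^ 2 := by
          have := entropyNum_nonneg U n
          gcongr
      _ = lam 0 := Real.sq_sqrt (hpos 0).le
  have : (2 * lam 0 + 2 * entropyNum U n ^ 2) * E ≤ 4 * lam 0 * E := by
    gcongr
    linarith
  linarith

end Relation

section RegularVariation

/-- Potter bounds in additive form. -/
theorem exists_abs_sub_sub_mul_le_of_tendsto_add_sub {h : ℝ → ℝ} {T₀ b ε : ℝ}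
    (hmono : ∀ t w, T₀ ≤ t → t ≤ w → h t ≤ h w)
    (hlim : ∀ L, 0 < L → Tendsto (fun t => h (t + L) - h t) atTop (nhds (b * L)))
    (hε : 0 < ε) (hεb : ε < b) :
    ∃ T, ∀ t w, T ≤ t → t ≤ w → |h w - h t - b * (w - t)| ≤ ε * (w - t) + ε := by
  set L := ε / (b + ε) with hL
  have hb : 0 < b + ε := by linarith
  have hL0 : 0 < L := by positivity
  have hbL : (b + ε) * L = ε := by rw [hL]; field_simp
  obtain ⟨T₁, hT₁⟩ := eventually_atTop.1
    ((Metric.tendsto_nhds.1 (hlim L hL0)) (ε * L) (by positivity))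
  have hstep : ∀ k : ℕ, ∀ t, T₁ ≤ t → |h (t + k * L) - h t - k * (b * L)| ≤ k * (ε * L) := by
    intro k t ht
    induction k with
    | zero => simp
    | succ k ih =>
      have hk := hT₁ (t + k * L) (by have : 0 ≤ k * L := by positivity
                                     linarith)
      rw [Real.dist_eq] at hk
      have e : t + (k + 1 : ℕ) * L = t + k * L + L := by push_cast; ring
      rw [e]
      rw [abs_le] at ih ⊢
      rw [abs_lt] at hk
      push_cast
      constructor <;> linarith [ih.1, ih.2, hk.1, hk.2]
  refine ⟨max T₀ T₁, fun t w ht htw => ?_⟩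
  have ht0 := le_trans (le_max_left _ _) ht
  have ht1 := le_trans (le_max_right _ _) ht
  set k := ⌊(w - t) / L⌋₊ with hk
  have hk1 : k * L ≤ w - t := (le_div_iff₀ hL0).1
    (Nat.floor_le (div_nonneg (sub_nonneg.2 htw) hL0.le))
  have hk2 : w - t < (k + 1) * L := (div_lt_iff₀ hL0).1 (Nat.lt_floor_add_one _)
  have hk0 : 0 ≤ k * L := by positivity
  have h1 := hmono (t + k * L) w (by linarith) (by linarith)
  have h2 := hmono w (t + (k + 1 : ℕ) * L) (by linarith) (by push_cast; linarith)
  have h3 := abs_le.1 (hstep k t ht1)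
  have h4 := abs_le.1 (hstep (k + 1) t ht1)
  push_cast at h2 h4
  have h5 : (b - ε) * (w - t - L) ≤ (b - ε) * (k * L) :=
    mul_le_mul_of_nonneg_left (by linarith) (by linarith)
  have h6 : (b + ε) * ((k + 1) * L) ≤ (b + ε) * (w - t + L) :=
    mul_le_mul_of_nonneg_left (by linarith) (by linarith)
  have h7 : 0 < ε * L := by positivity
  rw [abs_le]
  constructor
  · linarith [h3.1]
  · linarith [h4.2]

theorem exists_abs_log_div_sub_mul_log_le {φ : ℝ → ℝ} {s b ε : ℝ}
    (hφ_pos : ∀ x, s < x → 0 < φ x) (hφ_dec : ∀ x y, s < x → x ≤ y → φ y ≤ φ x)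
    (hφ_rv : ∀ c : ℝ, 0 < c → Tendsto (fun x : ℝ => φ (c * x) / φ x) atTop (nhds (c ^ (-b))))
    {lam : ℕ → ℝ} (hpos : ∀ j, 0 < lam j)
    (hasymp : Tendsto (fun j : ℕ => lam j / φ j) atTop (nhds 1))
    (hε : 0 < ε) (hεb : ε < b) :
    ∃ N : ℕ, 1 ≤ N ∧ ∀ i j : ℕ, N ≤ i → i ≤ j →
      |Real.log (lam i / lam j) - b * Real.log (j / i)| ≤ ε * Real.log (j / i) + ε := by
  set h : ℝ → ℝ := fun t => -Real.log (φ (rexp t)) with hh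
  have hsexp : ∀ t, max s 1 ≤ t → s < rexp t := fun t ht => by
    have h1 := Real.add_one_le_exp t
    have := le_trans (le_max_left _ _) ht
    linarith
  obtain ⟨T, hT⟩ := exists_abs_sub_sub_mul_le_of_tendsto_add_sub (h := h) (T₀ := max s 1) (b := b)
    (ε := ε / 3)
    (fun t w ht htw => neg_le_neg (Real.log_le_log
      (hφ_pos _ (hsexp w (ht.trans htw)))
      (hφ_dec _ _ (hsexp t ht) (Real.exp_le_exp.2 htw))))
    (fun L hL => by
      have h1 := ((hφ_rv (rexp L) (Real.exp_pos L)).comp Real.tendsto_exp_atTop).log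
        (by positivity)
      have h2 := h1.neg
      rw [Real.log_rpow (Real.exp_pos L), Real.log_exp, neg_mul, neg_neg] at h2
      refine h2.congr' ?_
      filter_upwards [eventually_ge_atTop (max s 1)] with t ht
      have e : rexp L * rexp t = rexp (t + L) := by rw [← Real.exp_add, add_comm]
      simp only [Function.comp_apply, hh, e]
      rw [Real.log_div (hφ_pos _ (hsexp _ (by linarith))).ne' (hφ_pos _ (hsexp _ ht)).ne']
      ring) (by linarith) (by linarith)
  have hlog0 := hasymp.log one_ne_zero
  rw [Real.log_one] at hlog0
  have hev := (Metric.tendsto_nhds.1 hlog0) (ε / 3) (by positivity)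
  have hev2 : ∀ᶠ i : ℕ in atTop, T ≤ Real.log i :=
    (Real.tendsto_log_atTop.comp tendsto_natCast_atTop_atTop).eventually_ge_atTop T
  have hev3 : ∀ᶠ i : ℕ in atTop, s < i := tendsto_natCast_atTop_atTop.eventually_gt_atTop s
  obtain ⟨N, hN⟩ := eventually_atTop.1 (hev.and (hev2.and hev3))
  refine ⟨max N 1, le_max_right _ _, fun i j hi hij => ?_⟩
  have hi0 : (0 : ℝ) < i := by exact_mod_cast lt_of_lt_of_le one_pos ((le_max_right _ _).trans hi)
  have hij' : (i : ℝ) ≤ j := by exact_mod_cast hij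
  have hj0 : (0 : ℝ) < j := hi0.trans_le hij'
  obtain ⟨a1, a2, a3⟩ := hN i ((le_max_left _ _).trans hi)
  obtain ⟨c1, c2, c3⟩ := hN j (((le_max_left _ _).trans hi).trans hij)
  have key := hT (Real.log i) (Real.log j) a2 (Real.log_le_log hi0 hij')
  simp only [hh, Real.exp_log hi0, Real.exp_log hj0] at key
  rw [Real.dist_eq, sub_zero, Real.log_div (hpos _).ne' (hφ_pos _ a3).ne', abs_lt] at a1
  rw [Real.dist_eq, sub_zero, Real.log_div (hpos _).ne' (hφ_pos _ c3).ne', abs_lt] at c1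
  rw [Real.log_div (hpos _).ne' (hpos _).ne', Real.log_div hj0.ne' hi0.ne']
  have h0 : 0 ≤ Real.log j - Real.log i := sub_nonneg.2 (Real.log_le_log hi0 hij')
  have h1 : 0 ≤ ε * (Real.log j - Real.log i) := by positivity
  rw [abs_le] at key ⊢
  constructor <;> linarith [key.1, key.2, a1.1, a1.2, c1.1, c1.2]

end RegularVariation

section PotterBounds

/-- The sequence `lam` satisfies two-sided Potter bounds of index `-b`. -/
def HasPotterBounds (b : ℝ) (lam : ℕ → ℝ) : Prop :=
  ∀ ε, 0 < ε → ε < b → ∃ N : ℕ, 1 ≤ N ∧ ∀ i j : ℕ, N ≤ i → i ≤ j →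
    |Real.log (lam i / lam j) - b * Real.log (j / i)| ≤ ε * Real.log (j / i) + ε

theorem tendsto_log_natCast_div_natCast :
    Tendsto (fun m : ℕ => Real.log m / m) atTop (nhds 0) :=
  (Real.isLittleO_log_id_atTop.tendsto_div_nhds_zero).comp tendsto_natCast_atTop_atTop

theorem tendsto_sum_log_div_div :
    Tendsto (fun m : ℕ => (∑ j ∈ Finset.range m, Real.log ((m : ℝ) / j)) / m) atTop (nhds 1) := by
  set d : ℕ → ℝ := fun m => m * Real.log (1 + 1 / m) with hd
  have hd1 : Tendsto d atTop (nhds 1) :=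
    (Real.tendsto_mul_log_one_add_div_atTop 1).comp tendsto_natCast_atTop_atTop
  have hA : ∀ m : ℕ, ∑ j ∈ Finset.range m, Real.log ((m : ℝ) / j) = ∑ k ∈ Finset.range m, d k := by
    intro m
    induction m with
    | zero => simp
    | succ m ih =>
      rcases Nat.eq_zero_or_pos m with rfl | hm
      · simp [hd]
      have hm0 : (0 : ℝ) < m := by exact_mod_cast hm
      rw [Finset.sum_range_succ, Finset.sum_range_succ, ← ih]
      have e : Real.log (1 + 1 / m) = Real.log ((m + 1 : ℕ) : ℝ) - Real.log m := by
        rw [← Real.log_div (by positivity) hm0.ne']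
        congr 1
        push_cast
        field_simp
      have h1 : ∀ m' : ℕ, 0 < m' → ∑ j ∈ Finset.range m, Real.log ((m' : ℝ) / j) =
          (m - 1) * Real.log m' - ∑ j ∈ Finset.range m, Real.log j := by
        intro m' hm'
        obtain ⟨p, rfl⟩ : ∃ p, m = p + 1 := ⟨m - 1, by omega⟩
        rw [Finset.sum_range_succ', Finset.sum_range_succ' (fun j => Real.log (j : ℝ))]
        have : ∀ j ∈ Finset.range p, Real.log ((m' : ℝ) / (j + 1 : ℕ)) =
            Real.log m' - Real.log ((j + 1 : ℕ) : ℝ) := fun j _ =>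
          Real.log_div (by positivity) (by positivity)
        rw [Finset.sum_congr rfl this]
        simp
      rw [h1 m hm, h1 (m + 1) (by omega), Real.log_div (by positivity) hm0.ne']
      simp only [hd]
      rw [e]
      ring
  simp_rw [hA]
  refine hd1.cesaro.congr fun m => ?_
  rw [inv_mul_eq_div]

variable {b : ℝ} {lam : ℕ → ℝ}

theorem HasPotterBounds.exists_pow_mul_ge (h : HasPotterBounds b lam) (hb : 0 < b)
    (hpos : ∀ j, 0 < lam j) : ∃ C : ℕ, ∀ᶠ m : ℕ in atTop, 1 ≤ (m : ℝ) ^ C * lam m := by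
  obtain ⟨N, hN1, hN⟩ := h (b / 2) (by positivity) (by linarith)
  obtain ⟨C, hC⟩ := exists_nat_ge (2 * b + 1)
  refine ⟨C, ?_⟩
  have hN0 : (0 : ℝ) < N := by exact_mod_cast hN1
  filter_upwards [eventually_ge_atTop N,
    (Real.tendsto_log_atTop.comp tendsto_natCast_atTop_atTop).eventually_ge_atTop
      (b / 2 - Real.log (lam N))] with m hm hlog
  have hm0 : (0 : ℝ) < m := by exact_mod_cast hN1.trans hm
  have h1 := (abs_le.1 (hN N m le_rfl hm)).2
  rw [Real.log_div (hpos _).ne' (hpos _).ne', Real.log_div hm0.ne' hN0.ne'] at h1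
  have hlN : 0 ≤ Real.log N := Real.log_nonneg (by exact_mod_cast hN1)
  have hlm : 0 ≤ Real.log m := Real.log_nonneg (by exact_mod_cast hN1.trans hm)
  simp only [Function.comp_apply] at hlog
  rw [← Real.log_nonneg_iff (mul_pos (pow_pos hm0 C) (hpos m)),
    Real.log_mul (pow_pos hm0 C).ne' (hpos m).ne', Real.log_pow]
  have h2 := mul_le_mul_of_nonneg_right hC hlm
  have h3 : 0 ≤ b * Real.log N := by positivity
  have h4 : 0 ≤ b * Real.log m := by positivity
  nlinarith

theorem HasPotterBounds.tendsto_log_div (h : HasPotterBounds b lam) (hb : 0 < b)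
    (hpos : ∀ j, 0 < lam j) (hanti : Antitone lam) :
    Tendsto (fun m : ℕ => Real.log (lam m) / m) atTop (nhds 0) := by
  obtain ⟨C, hC⟩ := h.exists_pow_mul_ge hb hpos
  have hl : Tendsto (fun m : ℕ => -(C * (Real.log m / m))) atTop (nhds 0) := by
    simpa using (tendsto_log_natCast_div_natCast.const_mul (C : ℝ)).neg
  refine tendsto_of_tendsto_of_tendsto_of_le_of_le' hl
    (tendsto_const_div_atTop_nhds_zero_nat (Real.log (lam 0))) ?_ ?_
  · filter_upwards [hC, eventually_gt_atTop 0] with m hm hm0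
    have hm0' : (0 : ℝ) < m := by exact_mod_cast hm0
    have h1 := Real.log_nonneg hm
    rw [Real.log_mul (pow_pos hm0' C).ne' (hpos m).ne', Real.log_pow] at h1
    rw [← mul_div_assoc, ← neg_div]
    gcongr
    linarith
  · filter_upwards with m
    have := Real.log_le_log (hpos m) (hanti (Nat.zero_le m))
    gcongr

theorem HasPotterBounds.tendsto_sum_log (h : HasPotterBounds b lam) (hb : 0 < b)
    (hpos : ∀ j, 0 < lam j) (hanti : Antitone lam) :
    Tendsto (fun m : ℕ => (∑ j ∈ Finset.range m, Real.log (lam j / lam m)) / m) atTop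
      (nhds b) := by
  set D : ℕ → ℕ → ℝ := fun j m => Real.log (lam j / lam m) - b * Real.log ((m : ℝ) / j) with hD
  have hD0 : Tendsto (fun m : ℕ => (∑ j ∈ Finset.range m, D j m) / m) atTop (nhds 0) := by
    have hfix : ∀ j, Tendsto (fun m : ℕ => |D j m| / m) atTop (nhds 0) := by
      intro j
      have h1 := ((tendsto_const_div_atTop_nhds_zero_nat (Real.log (lam j))).sub
        (h.tendsto_log_div hb hpos hanti)).sub
        ((tendsto_log_natCast_div_natCast.const_mul b).sub
          (tendsto_const_div_atTop_nhds_zero_nat (b * Real.log j)))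
      simp only [sub_zero, mul_zero] at h1
      rcases Nat.eq_zero_or_pos j with rfl | hj
      · have h1 := ((tendsto_const_div_atTop_nhds_zero_nat (Real.log (lam 0))).sub
          (h.tendsto_log_div hb hpos hanti)).abs
        rw [sub_zero, abs_zero] at h1
        refine h1.congr fun m => ?_
        simp only [hD, Nat.cast_zero, div_zero, Real.log_zero, mul_zero, sub_zero]
        rw [Real.log_div (hpos _).ne' (hpos _).ne', ← sub_div, abs_div, Nat.abs_cast]
      · have h2 := h1.abs
        rw [abs_zero] at h2
        refine h2.congr' ?_
        filter_upwards [eventually_gt_atTop 0] with m hm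
        have hm0 : (m : ℝ) ≠ 0 := by positivity
        have hj0 : (j : ℝ) ≠ 0 := by positivity
        simp only [hD]
        rw [Real.log_div (hpos _).ne' (hpos _).ne', Real.log_div hm0 hj0, ← Nat.abs_cast m,
          ← abs_div, Nat.abs_cast]
        congr 1
        ring
    rw [Metric.tendsto_nhds]
    intro η hη
    set ε := min (η / 8) (b / 2) with hε
    have hε0 : 0 < ε := by positivity
    have hεη : ε ≤ η / 8 := min_le_left _ _
    obtain ⟨N, hN1, hN⟩ := h ε hε0 (lt_of_le_of_lt (min_le_right _ _) (by linarith))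
    have hfin : Tendsto (fun m : ℕ => ∑ j ∈ Finset.range N, |D j m| / m) atTop (nhds 0) := by
      simpa using tendsto_finsetSum (Finset.range N) fun j _ => hfix j
    filter_upwards [hfin.eventually_lt_const (u := η / 4) (by positivity),
      tendsto_sum_log_div_div.eventually_lt_const (u := 2) (by norm_num),
      eventually_ge_atTop N] with m h1 h2 hm
    have hm0 : (0 : ℝ) < m := by exact_mod_cast hN1.trans hm
    rw [Real.dist_eq, sub_zero, abs_div, Nat.abs_cast]
    rw [← Finset.sum_div] at h1
    rw [div_lt_iff₀ hm0] at h1 h2 ⊢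
    have hlog0 : ∀ j ∈ Finset.range m, 0 ≤ Real.log ((m : ℝ) / j) := fun j hj => by
      rcases Nat.eq_zero_or_pos j with rfl | hj0
      · simp
      · refine Real.log_nonneg ((one_le_div (by exact_mod_cast hj0)).2 ?_)
        exact_mod_cast (Finset.mem_range.1 hj).le
    calc |∑ j ∈ Finset.range m, D j m| ≤ ∑ j ∈ Finset.range m, |D j m| :=
          Finset.abs_sum_le_sum_abs _ _
      _ = ∑ j ∈ Finset.range N, |D j m| + ∑ j ∈ Finset.Ico N m, |D j m| :=
          (Finset.sum_range_add_sum_Ico _ hm).symm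
      _ ≤ η / 4 * m + ∑ j ∈ Finset.Ico N m, (ε * Real.log ((m : ℝ) / j) + ε) := by
          refine add_le_add h1.le (Finset.sum_le_sum fun j hj => ?_)
          rw [Finset.mem_Ico] at hj
          exact hN j m hj.1 hj.2.le
      _ ≤ η / 4 * m + ∑ j ∈ Finset.range m, (ε * Real.log ((m : ℝ) / j) + ε) := by
          refine add_le_add le_rfl (Finset.sum_le_sum_of_subset_of_nonneg ?_ fun j hj _ => ?_)
          · intro j hj
            exact Finset.mem_range.2 (Finset.mem_Ico.1 hj).2
          · have := hlog0 j hj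
            positivity
      _ = η / 4 * m + (ε * ∑ j ∈ Finset.range m, Real.log ((m : ℝ) / j) + m * ε) := by
          rw [Finset.sum_add_distrib, ← Finset.mul_sum]
          simp
      _ < η * m := by
          have h3 := mul_lt_mul_of_pos_left h2 hε0
          have h4 := mul_le_mul_of_nonneg_right hεη hm0.le
          have h5 : 0 < η * m := by positivity
          linarith
  have := hD0.add (tendsto_sum_log_div_div.const_mul b)
  rw [zero_add, mul_one] at this
  refine this.congr fun m => ?_
  rw [← mul_div_assoc, ← add_div, Finset.mul_sum, ← Finset.sum_add_distrib]
  simp [hD]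

end PotterBounds

section TailSums

theorem rpow_neg_sub_mul_le_rpow_neg {x y q : ℝ} (hx : 0 < x) (hy : 0 < y) (hq : 0 ≤ q) :
    x ^ (-q) - q * x ^ (-(q + 1)) * (y - x) ≤ y ^ (-q) := by
  have h1 : 1 - q * (y / x - 1) ≤ (y / x) ^ (-q) := by
    rw [Real.rpow_def_of_pos (by positivity)]
    have h2 := Real.add_one_le_exp (Real.log (y / x) * -q)
    have h3 := mul_le_mul_of_nonneg_left (Real.log_le_sub_one_of_pos (div_pos hy hx)) hq
    linarith
  rw [Real.div_rpow hy.le hx.le, le_div_iff₀ (by positivity)] at h1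
  refine le_trans (le_of_eq ?_) h1
  rw [show -(q + 1) = -q - 1 by ring, Real.rpow_sub_one hx.ne']
  field_simp

theorem summable_rpow_neg_and_tsum_bounds {q : ℝ} (hq : 0 < q) {m : ℕ} (hm : 1 ≤ m) :
    Summable (fun j : ℕ => (((j + m : ℕ) : ℝ) / m) ^ (-(q + 1))) ∧
      m / q ≤ ∑' j : ℕ, (((j + m : ℕ) : ℝ) / m) ^ (-(q + 1)) ∧
      ∑' j : ℕ, (((j + m : ℕ) : ℝ) / m) ^ (-(q + 1)) ≤ 1 + m / q := by
  have hm0 : (0 : ℝ) < m := by exact_mod_cast hm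
  set v : ℕ → ℝ := fun j => ((j + m : ℕ) : ℝ) / m with hv
  have hv0 : ∀ j, 0 < v j := fun j => by
    have : 0 < j + m := by omega
    simp only [hv]
    positivity
  have hvs : ∀ j, v (j + 1) - v j = 1 / m := fun j => by
    simp only [hv]
    push_cast
    field_simp
    ring
  set g : ℕ → ℝ := fun j => v j ^ (-(q + 1)) with hg
  have hg0 : ∀ j, 0 ≤ g j := fun j => (Real.rpow_pos_of_pos (hv0 j) _).le
  have hup : ∀ j, v j ^ (-q) - v (j + 1) ^ (-q) ≤ q / m * g j := fun j => by
    have := rpow_neg_sub_mul_le_rpow_neg (hv0 j) (hv0 (j + 1)) hq.le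
    rw [hvs] at this
    have e : q / m * g j = q * v j ^ (-(q + 1)) * (1 / m) := by simp only [hg]; ring
    linarith
  have hlo : ∀ j, q / m * g (j + 1) ≤ v j ^ (-q) - v (j + 1) ^ (-q) := fun j => by
    have := rpow_neg_sub_mul_le_rpow_neg (hv0 (j + 1)) (hv0 j) hq.le
    rw [← neg_sub (v (j + 1)), hvs] at this
    have e : q / m * g (j + 1) = q * v (j + 1) ^ (-(q + 1)) * (1 / m) := by
      simp only [hg]
      ring
    linarith
  have htel : HasSum (fun j => v j ^ (-q) - v (j + 1) ^ (-q)) 1 := by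
    rw [hasSum_iff_tendsto_nat_of_nonneg fun j => le_trans (by have := hg0 (j + 1)
                                                               positivity) (hlo j)]
    simp_rw [Finset.sum_range_sub' (fun j => v j ^ (-q))]
    have hvt : Tendsto v atTop atTop :=
      (tendsto_natCast_atTop_atTop.comp (tendsto_add_atTop_nat m)).atTop_div_const hm0
    have e : v 0 ^ (-q) = 1 := by
      simp only [hv, zero_add]
      rw [div_self hm0.ne', Real.one_rpow]
    rw [e]
    simpa using ((tendsto_rpow_neg_atTop hq).comp hvt).const_sub 1
  have hg1 : Summable fun j => q / m * g (j + 1) :=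
    Summable.of_nonneg_of_le (fun j => by have := hg0 (j + 1)
                                          positivity) hlo htel.summable
  have hgs1 : Summable fun j => g (j + 1) := (summable_mul_left_iff (by positivity)).1 hg1
  have hgs : Summable g := (summable_nat_add_iff 1).1 hgs1
  refine ⟨hgs, ?_, ?_⟩
  · have := htel.summable.tsum_le_tsum hup (hgs.mul_left _)
    rw [htel.tsum_eq, tsum_mul_left] at this
    rw [div_le_iff₀ hq]
    have e := mul_le_mul_of_nonneg_left this hm0.le
    rw [mul_one, ← mul_assoc, mul_div_cancel₀ _ hm0.ne'] at e
    linarith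
  · have := hg1.tsum_le_tsum hlo htel.summable
    rw [htel.tsum_eq, tsum_mul_left] at this
    have e := mul_le_mul_of_nonneg_left this hm0.le
    rw [mul_one, ← mul_assoc, mul_div_cancel₀ _ hm0.ne'] at e
    have e0 : g 0 = 1 := by
      simp only [hg, hv, zero_add]
      rw [div_self hm0.ne', Real.one_rpow]
    rw [hgs.tsum_eq_zero_add, e0]
    gcongr
    rw [le_div_iff₀ hq]
    linarith

variable {b : ℝ} {lam : ℕ → ℝ}

theorem HasPotterBounds.exists_div_mem (h : HasPotterBounds b lam) (hpos : ∀ j, 0 < lam j)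
    {ε : ℝ} (hε : 0 < ε) (hεb : ε < b) :
    ∃ N : ℕ, 1 ≤ N ∧ ∀ i j : ℕ, N ≤ i → i ≤ j →
      rexp (-ε) * ((j : ℝ) / i) ^ (-(b + ε)) * lam i ≤ lam j ∧
        lam j ≤ rexp ε * ((j : ℝ) / i) ^ (-(b - ε)) * lam i := by
  obtain ⟨N, hN1, hN⟩ := h ε hε hεb
  refine ⟨N, hN1, fun i j hi hij => ?_⟩
  have hi0 : (0 : ℝ) < i := by exact_mod_cast hN1.trans hi
  have hj0 : (0 : ℝ) < j := by exact_mod_cast (hN1.trans hi).trans hij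
  have hb := abs_le.1 (hN i j hi hij)
  have hd : (0 : ℝ) < j / i := div_pos hj0 hi0
  rw [Real.log_div (hpos _).ne' (hpos _).ne'] at hb
  have e1 : lam i = rexp (Real.log (lam i)) := (Real.exp_log (hpos i)).symm
  rw [Real.rpow_def_of_pos hd, Real.rpow_def_of_pos hd, e1, ← Real.exp_add, ← Real.exp_add,
    ← Real.exp_add, ← Real.exp_add]
  constructor
  · rw [← Real.le_log_iff_exp_le (hpos j)]
    linarith [hb.2]
  · rw [← Real.log_le_iff_le_exp (hpos j)]
    linarith [hb.1]

theorem HasPotterBounds.eventually_tsum_bounds (h : HasPotterBounds b lam)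
    (hpos : ∀ j, 0 < lam j) {ε : ℝ} (hε : 0 < ε) (hεb : ε < b - 1) :
    ∀ᶠ m : ℕ in atTop, Summable (fun j => lam (j + m)) ∧
      rexp (-ε) * (1 / (b - 1 + ε)) ≤ (∑' j, lam (j + m)) / (m * lam m) ∧
      (∑' j, lam (j + m)) / (m * lam m) ≤ rexp ε * (1 / m + 1 / (b - 1 - ε)) := by
  obtain ⟨N, hN1, hN⟩ := h.exists_div_mem hpos hε (by linarith)
  filter_upwards [eventually_ge_atTop N] with m hm
  have hm1 : 1 ≤ m := hN1.trans hm
  have hm0 : (0 : ℝ) < m := by exact_mod_cast hm1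
  have hlm := hpos m
  obtain ⟨s1, -, u1⟩ := summable_rpow_neg_and_tsum_bounds (q := b - 1 - ε) (by linarith) hm1
  obtain ⟨s2, l2, -⟩ := summable_rpow_neg_and_tsum_bounds (q := b - 1 + ε) (by linarith) hm1
  rw [show b - 1 - ε + 1 = b - ε by ring] at s1 u1
  rw [show b - 1 + ε + 1 = b + ε by ring] at s2 l2
  have hup : ∀ j, lam (j + m) ≤ rexp ε * lam m * (((j + m : ℕ) : ℝ) / m) ^ (-(b - ε)) := fun j =>
    ((hN m (j + m) hm (Nat.le_add_left m j)).2).trans_eq (by ring)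
  have hlo : ∀ j, rexp (-ε) * lam m * (((j + m : ℕ) : ℝ) / m) ^ (-(b + ε)) ≤ lam (j + m) := fun j =>
    le_trans (le_of_eq (by ring)) (hN m (j + m) hm (Nat.le_add_left m j)).1
  have hs : Summable fun j => lam (j + m) :=
    Summable.of_nonneg_of_le (fun j => (hpos _).le) hup (s1.mul_left _)
  refine ⟨hs, ?_, ?_⟩
  · have := (s2.mul_left _).tsum_le_tsum hlo hs
    rw [tsum_mul_left] at this
    rw [le_div_iff₀ (by positivity)]
    refine le_trans (le_of_eq ?_) ((mul_le_mul_of_nonneg_left l2 (by positivity)).trans this)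
    ring
  · have := hs.tsum_le_tsum hup (s1.mul_left _)
    rw [tsum_mul_left] at this
    rw [div_le_iff₀ (by positivity)]
    refine (this.trans (mul_le_mul_of_nonneg_left u1 (by positivity))).trans_eq ?_
    field_simp

theorem HasPotterBounds.summable (h : HasPotterBounds b lam) (hb : 1 < b)
    (hpos : ∀ j, 0 < lam j) : Summable lam := by
  obtain ⟨m, hm, -⟩ := (h.eventually_tsum_bounds hpos (ε := (b - 1) / 2) (by linarith)
    (by linarith)).exists
  exact (summable_nat_add_iff m).1 hm

theorem HasPotterBounds.tendsto_tsum_div (h : HasPotterBounds b lam) (hb : 1 < b)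
    (hpos : ∀ j, 0 < lam j) :
    Tendsto (fun m : ℕ => (∑' j, lam (j + m)) / (m * lam m)) atTop (nhds (1 / (b - 1))) := by
  have hb1 : b - 1 ≠ 0 := by linarith
  have hsmall : ∀ᶠ ε : ℝ in nhdsWithin 0 (Set.Ioi 0), 0 < ε ∧ ε < b - 1 :=
    Ioo_mem_nhdsGT (by linarith)
  refine tendsto_order.2 ⟨fun a ha => ?_, fun a ha => ?_⟩
  · have hc : ContinuousAt (fun ε : ℝ => rexp (-ε) * (1 / (b - 1 + ε))) 0 := by
      refine ContinuousAt.mul (by fun_prop) (continuousAt_const.div (by fun_prop) (by simpa))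
    have hev : ∀ᶠ ε : ℝ in nhdsWithin 0 (Set.Ioi 0), a < rexp (-ε) * (1 / (b - 1 + ε)) :=
      (hc.tendsto.mono_left nhdsWithin_le_nhds).eventually_const_lt (by simpa using ha)
    obtain ⟨ε, hε, hε0, hε1⟩ := (hev.and hsmall).exists
    filter_upwards [h.eventually_tsum_bounds hpos hε0 hε1] with m hm
    exact hε.trans_le hm.2.1
  · have hc : ContinuousAt (fun ε : ℝ => rexp ε * (ε + 1 / (b - 1 - ε))) 0 := by
      refine ContinuousAt.mul (by fun_prop) (continuousAt_id.add
        (continuousAt_const.div (by fun_prop) (by simpa)))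
    have hev : ∀ᶠ ε : ℝ in nhdsWithin 0 (Set.Ioi 0), rexp ε * (ε + 1 / (b - 1 - ε)) < a :=
      (hc.tendsto.mono_left nhdsWithin_le_nhds).eventually_lt_const (by simpa using ha)
    obtain ⟨ε, hε, hε0, hε1⟩ := (hev.and hsmall).exists
    filter_upwards [h.eventually_tsum_bounds hpos hε0 hε1,
      tendsto_one_div_atTop_nhds_zero_nat.eventually_lt_const hε0] with m hm hm'
    refine hm.2.2.trans_lt (lt_of_le_of_lt ?_ hε)
    gcongr

end TailSums

section Asymptotics

theorem tendsto_floor_mul_log_atTop {a : ℝ} (ha : 0 < a) :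
    Tendsto (fun n : ℕ => ⌊a * Real.log n⌋₊) atTop atTop :=
  tendsto_nat_floor_atTop.comp ((Real.tendsto_log_atTop.comp
    tendsto_natCast_atTop_atTop).const_mul_atTop ha)

theorem tendsto_floor_mul_log_div_log {a : ℝ} (ha : 0 < a) :
    Tendsto (fun n : ℕ => (⌊a * Real.log n⌋₊ : ℝ) / Real.log n) atTop (nhds a) :=
  (tendsto_nat_floor_mul_div_atTop ha.le).comp
    (Real.tendsto_log_atTop.comp tendsto_natCast_atTop_atTop)

theorem tendsto_floor_mul_log_div_floor_mul_log {a c : ℝ} (ha : 0 < a) (hc : 0 < c) :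
    Tendsto (fun n : ℕ => (⌊a * Real.log n⌋₊ : ℝ) / ⌊c * Real.log n⌋₊) atTop (nhds (a / c)) := by
  refine ((tendsto_floor_mul_log_div_log ha).div (tendsto_floor_mul_log_div_log hc) hc.ne').congr' ?_
  filter_upwards [(Real.tendsto_log_atTop.comp tendsto_natCast_atTop_atTop).eventually_gt_atTop 0]
    with n hn
  exact div_div_div_cancel_right₀ (ne_of_gt hn) _ _

variable {H : Type*} [NormedAddCommGroup H] [InnerProductSpace ℝ H] [CompleteSpace H]
  {u : ℕ → H} {lam : ℕ → ℝ} {b : ℝ}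

theorem HasPotterBounds.eventually_entropyNum_sq_div_lt (h : HasPotterBounds b lam) (hb : 0 < b)
    (hu : Orthonormal ℝ u) (hpos : ∀ j, 0 < lam j) (hanti : Antitone lam) {c : ℝ} (hc : 1 < c) :
    ∀ᶠ n : ℕ in atTop, entropyNum {x ∈ closure (Submodule.span ℝ (Set.range u) : Set H) |
        Summable (fun j => ⟪x, u j⟫ ^ 2 / lam j) ∧ ∑' j, ⟪x, u j⟫ ^ 2 / lam j ≤ 1} n ^ 2 /
      lam ⌊2 / b * Real.log n⌋₊ < c := by
  obtain ⟨C, hC⟩ := h.exists_pow_mul_ge hb hpos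
  have hcont : ContinuousAt
      (fun ε : ℝ => (1 + ε) * (rexp ε * (1 + 3 * ε / b) ^ (b + ε))) 0 := by
    refine ContinuousAt.mul (by fun_prop) (ContinuousAt.mul (by fun_prop) ?_)
    exact ContinuousAt.rpow (by fun_prop) (by fun_prop) (Or.inl (by simp))
  have hev : ∀ᶠ ε : ℝ in nhdsWithin 0 (Set.Ioi 0),
      (1 + ε) * (rexp ε * (1 + 3 * ε / b) ^ (b + ε)) < c :=
    (hcont.tendsto.mono_left nhdsWithin_le_nhds).eventually_lt_const (by simpa using hc)
  have hsmall : ∀ᶠ ε : ℝ in nhdsWithin 0 (Set.Ioi 0), 0 < ε ∧ ε < b := Ioo_mem_nhdsGT hb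
  obtain ⟨ε, hεc, hε, hεb⟩ := (hev.and hsmall).exists
  obtain ⟨N, hN1, hN⟩ := h.exists_div_mem hpos hε hεb
  have hd : 0 < b / 2 + ε := by positivity
  have hk := tendsto_floor_mul_log_atTop (a := 1 / (b / 2 + ε)) (by positivity)
  have hmk := tendsto_floor_mul_log_div_floor_mul_log (a := 2 / b) (c := 1 / (b / 2 + ε))
    (by positivity) (by positivity)
  have hlt : 2 / b / (1 / (b / 2 + ε)) < 1 + 3 * ε / b := by
    have e : 2 / b / (1 / (b / 2 + ε)) = 1 + 2 * ε / b := by field_simp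
    rw [e]
    gcongr
    norm_num
  filter_upwards [hk.eventually (eventually_entropyNum_sq_le hu hpos hanti hb
    (h.tendsto_sum_log hb hpos hanti) hC hε), hk.eventually_ge_atTop N,
    hmk.eventually_lt_const hlt, eventually_ge_atTop 1] with n h1 h2 h3 hn
  set k := ⌊1 / (b / 2 + ε) * Real.log n⌋₊ with hkdef
  set m := ⌊2 / b * Real.log n⌋₊ with hmdef
  have hn0 : (0 : ℝ) < n := by exact_mod_cast hn
  have hl0 : 0 ≤ Real.log n := Real.log_nonneg (by exact_mod_cast hn)
  have hkm : k ≤ m := by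
    refine Nat.floor_le_floor (mul_le_mul_of_nonneg_right ?_ hl0)
    rw [div_le_div_iff₀ hd hb]
    linarith
  have hk0 : (0 : ℝ) < k := by exact_mod_cast hN1.trans h2
  have hm0 : (0 : ℝ) < m := by exact_mod_cast (hN1.trans h2).trans hkm
  have hkn : rexp ((b / 2 + ε) * k) ≤ n := by
    rw [← Real.le_log_iff_exp_le hn0]
    have := Nat.floor_le (a := 1 / (b / 2 + ε) * Real.log n) (by positivity)
    calc (b / 2 + ε) * k ≤ (b / 2 + ε) * (1 / (b / 2 + ε) * Real.log n) := by gcongr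
      _ = Real.log n := by field_simp
  have hw := h1 n hkn
  have hkl := (hN k m h2 hkm).1
  have hpw : (0 : ℝ) < ((m : ℝ) / k) ^ (b + ε) := by positivity
  have hlk : lam k ≤ rexp ε * ((m : ℝ) / k) ^ (b + ε) * lam m := by
    rw [Real.exp_neg, Real.rpow_neg (by positivity), ← mul_inv, inv_mul_le_iff₀ (by positivity)]
      at hkl
    exact hkl
  rw [div_lt_iff₀ (hpos m)]
  calc _ ≤ lam k * (1 + ε) := hw
    _ ≤ rexp ε * ((m : ℝ) / k) ^ (b + ε) * lam m * (1 + ε) := by gcongr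
    _ ≤ rexp ε * (1 + 3 * ε / b) ^ (b + ε) * lam m * (1 + ε) := by
        have := (hpos m).le
        gcongr
    _ = (1 + ε) * (rexp ε * (1 + 3 * ε / b) ^ (b + ε)) * lam m := by ring
    _ < c * lam m := by
        have := hpos m
        gcongr

theorem HasPotterBounds.eventually_const_mul_exp_le (h : HasPotterBounds b lam) (hb : 0 < b)
    (hpos : ∀ j, 0 < lam j) (K : ℝ) {δ ε : ℝ} (hδ : 0 < δ) (hε : 0 < ε) :
    ∀ᶠ m : ℕ in atTop, K * rexp (-(δ * m)) ≤ ε * (m * lam m) := by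
  obtain ⟨C, hC⟩ := h.exists_pow_mul_ge hb hpos
  filter_upwards [hC, eventually_const_mul_pow_le_exp (K / ε) C hδ, eventually_ge_atTop 1]
    with m h1 h2 hm
  have hm1 : (1 : ℝ) ≤ m := by exact_mod_cast hm
  have hlm := hpos m
  rw [Real.exp_neg, ← div_eq_mul_inv, div_le_iff₀ (Real.exp_pos _)]
  rcases le_or_gt K 0 with hK | hK
  · exact hK.trans (by positivity)
  calc K ≤ K * ((m : ℝ) ^ C * lam m) := le_mul_of_one_le_right hK.le h1
    _ = ε * (K / ε * (m : ℝ) ^ C) * lam m := by field_simp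
    _ ≤ ε * rexp (δ * m) * (m * lam m) := by
        gcongr
        exact le_mul_of_one_le_left hlm.le hm1
    _ = ε * (m * lam m) * rexp (δ * m) := by ring

end Asymptotics

section Squeeze

/-- If `x ≥ z`, `y` is asymptotically at most `1` and `x - t ≤ (1 + ε) y + ε` eventually for every
small `ε`, where `z → 1 + l` and `t → l`, then `x → 1 + l` and `y → 1`. -/
theorem tendsto_of_eventually_sub_le {x y z t : ℕ → ℝ} {l : ℝ}
    (hz : Tendsto z atTop (nhds (1 + l))) (ht : Tendsto t atTop (nhds l))
    (hzx : ∀ᶠ n in atTop, z n ≤ x n) (hy : ∀ c, 1 < c → ∀ᶠ n in atTop, y n < c)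
    (hxy : ∀ ε, 0 < ε → ε ≤ 1 → ∀ᶠ n in atTop, x n - t n ≤ (1 + ε) * y n + ε) :
    Tendsto x atTop (nhds (1 + l)) ∧ Tendsto y atTop (nhds 1) := by
  constructor
  · refine tendsto_order.2 ⟨fun a ha => ?_, fun a ha => ?_⟩
    · filter_upwards [hz.eventually_const_lt ha, hzx] with n h1 h2 using h1.trans_le h2
    · set ε := min 1 ((a - (1 + l)) / 8) with hε
      have hε0 : 0 < ε := lt_min one_pos (by linarith)
      have hε1 : ε ≤ 1 := min_le_left _ _
      have hε8 : ε ≤ (a - (1 + l)) / 8 := min_le_right _ _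
      filter_upwards [hxy ε hε0 hε1, hy (1 + ε) (by linarith),
        ht.eventually_lt_const (u := l + ε) (by linarith)] with n h1 h2 h3
      have h4 : (1 + ε) * y n ≤ (1 + ε) * (1 + ε) := by gcongr
      nlinarith
  · refine tendsto_order.2 ⟨fun a ha => ?_, hy⟩
    have hc : ContinuousAt (fun ε : ℝ => (1 - 2 * ε) / (1 + ε)) 0 :=
      ContinuousAt.div (by fun_prop) (by fun_prop) (by simp)
    have hev : ∀ᶠ ε : ℝ in nhdsWithin 0 (Set.Ioi 0), a < (1 - 2 * ε) / (1 + ε) :=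
      (hc.tendsto.mono_left nhdsWithin_le_nhds).eventually_const_lt (by simpa using ha)
    have hsmall : ∀ᶠ ε : ℝ in nhdsWithin 0 (Set.Ioi 0), 0 < ε ∧ ε < 1 := Ioo_mem_nhdsGT one_pos
    obtain ⟨ε, hεa, hε0, hε1⟩ := (hev.and hsmall).exists
    have hzt := hz.sub ht
    rw [add_sub_cancel_right] at hzt
    filter_upwards [hxy ε hε0 hε1.le, hzx, hzt.eventually_const_lt (u := 1 - ε) (by linarith)]
      with n h1 h2 h3
    refine hεa.trans ?_
    rw [div_lt_iff₀ (by positivity)]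
    linarith

end Squeeze

theorem HasPotterBounds.tendsto_quantErr_div_entropyNum
    {H : Type*} [NormedAddCommGroup H] [InnerProductSpace ℝ H] [CompleteSpace H]
    {Ω : Type*} [MeasurableSpace Ω] {P : Measure Ω} [IsProbabilityMeasure P] {X : Ω → H}
    {u : ℕ → H} {lam : ℕ → ℝ} {b : ℝ} (h : HasPotterBounds b lam) (hb : 1 < b)
    (hXmeas : AEStronglyMeasurable X P) (hXint : Integrable (fun ω => ‖X ω‖ ^ 2) P)
    (hGauss : ∀ y : H, ∃ v : ℝ≥0, Measure.map (fun ω => ⟪y, X ω⟫) P = gaussianReal 0 v)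
    (hu : Orthonormal ℝ u) (hpos : ∀ j, 0 < lam j) (hanti : Antitone lam)
    (heig : ∀ j, ∀ y : H, ∫ ω, ⟪u j, X ω⟫ * ⟪y, X ω⟫ ∂P = lam j * ⟪u j, y⟫)
    (hspan : ∀ᵐ ω ∂P, X ω ∈ closure (Submodule.span ℝ (Set.range u) : Set H)) :
    Tendsto (fun n : ℕ => quantErr P X n / ((2 * Real.log n / (b - 1)) ^ (1 / 2 : ℝ) *
      entropyNum {x ∈ closure (Submodule.span ℝ (Set.range u) : Set H) |
        Summable (fun j => ⟪x, u j⟫ ^ 2 / lam j) ∧ ∑' j, ⟪x, u j⟫ ^ 2 / lam j ≤ 1} n))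
      atTop (nhds 1) := by
  set U := {x ∈ closure (Submodule.span ℝ (Set.range u) : Set H) |
        Summable (fun j => ⟪x, u j⟫ ^ 2 / lam j) ∧ ∑' j, ⟪x, u j⟫ ^ 2 / lam j ≤ 1} with hU
  have hb0 : 0 < b := by linarith
  have hb1 : 0 < b - 1 := by linarith
  have hsum := h.summable hb hpos
  set m : ℕ → ℕ := fun n => ⌊2 / b * Real.log n⌋₊ with hm
  have hmt : Tendsto m atTop atTop := tendsto_floor_mul_log_atTop (by positivity)
  have hml : Tendsto (fun n : ℕ => (m n : ℝ) / Real.log n) atTop (nhds (2 / b)) :=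
    tendsto_floor_mul_log_div_log (by positivity)
  have hlm : Tendsto (fun n : ℕ => Real.log n / m n) atTop (nhds (b / 2)) := by
    simpa using hml.inv₀ (by positivity)
  have hlogpos : ∀ᶠ n : ℕ in atTop, 0 < Real.log n :=
    (Real.tendsto_log_atTop.comp tendsto_natCast_atTop_atTop).eventually_gt_atTop 0
  have ht := (h.tendsto_tsum_div hb hpos).comp hmt
  have hR := (h.tendsto_sum_log hb0 hpos hanti).comp hmt
  have hz := ((ht.const_add 1).add (hR.sub (hlm.const_mul 2)))
  rw [show 1 + 1 / (b - 1) + (b - 2 * (b / 2)) = 1 + 1 / (b - 1) by ring] at hz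
  obtain ⟨hx, hy⟩ := tendsto_of_eventually_sub_le
    (x := fun n => quantErr P X n ^ 2 / (m n * lam (m n)))
    (y := fun n => entropyNum U n ^ 2 / lam (m n)) hz ht
    (by
      filter_upwards [hmt.eventually_ge_atTop 1, eventually_ge_atTop 1] with n hm1 hn
      have hm0 : (0 : ℝ) < m n := by exact_mod_cast hm1
      have hl0 := hpos (m n)
      have := le_quantErr_sq_of_summable hXmeas hXint hGauss hu hpos hanti hsum heig (m n) hn
      rw [le_div_iff₀ (by positivity)]
      refine le_trans (le_of_eq ?_) this
      simp only [Function.comp_apply]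
      field_simp)
    (fun c hc => h.eventually_entropyNum_sq_div_lt hb0 hu hpos hanti hc)
    (fun ε hε hε1 => by
      filter_upwards [hmt.eventually_ge_atTop 1, eventually_ge_atTop 1,
        hmt.eventually (h.eventually_const_mul_exp_le hb0 hpos (4 * lam 0 * (128 / ε ^ 2))
          (δ := ε ^ 2 / 64) (by positivity) hε)] with n hm1 hn hE
      have hm0 : (0 : ℝ) < m n := by exact_mod_cast hm1
      have hl0 := hpos (m n)
      have := quantErr_sq_le_entropyNum_sq hXmeas hXint hGauss hu hpos hanti hsum heig hspan hn
        hm1 hε hε1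
      simp only [Function.comp_apply]
      rw [← sub_div, div_le_iff₀ (by positivity)]
      have e : ((1 + ε) * (entropyNum U n ^ 2 / lam (m n)) + ε) * (m n * lam (m n)) =
          m n * (1 + ε) * entropyNum U n ^ 2 + ε * (m n * lam (m n)) := by field_simp
      rw [e]
      linarith)
  have hquot : Tendsto (fun n => (quantErr P X n ^ 2 / (m n * lam (m n))) *
      ((m n : ℝ) / Real.log n) * ((b - 1) / 2) / (entropyNum U n ^ 2 / lam (m n))) atTop
      (nhds 1) := by
    have := ((hx.mul hml).mul_const ((b - 1) / 2)).div hy one_ne_zero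
    have e : (1 + 1 / (b - 1)) * (2 / b) * ((b - 1) / 2) / 1 = 1 := by
      field_simp
      ring
    rwa [e] at this
  have hsqrt := hquot.sqrt
  rw [Real.sqrt_one] at hsqrt
  refine hsqrt.congr' ?_
  filter_upwards [hlogpos, hmt.eventually_ge_atTop 1] with n hn hm1
  have hm0 : (m n : ℝ) ≠ 0 := by
    have : (0 : ℝ) < m n := by exact_mod_cast hm1
    exact this.ne'
  have hl0 := (hpos (m n)).ne'
  rw [← Real.sqrt_eq_rpow, ← Real.sqrt_sq (quantErr_nonneg (P := P) (X := X) n),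
    ← Real.sqrt_sq (entropyNum_nonneg U n), ← Real.sqrt_mul (by positivity),
    ← Real.sqrt_div (sq_nonneg _)]
  congr 1
  rw [Real.sq_sqrt (sq_nonneg _), Real.sq_sqrt (sq_nonneg _)]
  rcases eq_or_ne (entropyNum U n) 0 with h0 | h0
  · simp [h0]
  · field_simp

/-- The quantization errors and the entropy numbers of the Cameron–Martin unit ball of
a centered Gaussian random vector with regularly varying covariance eigenvalues are
related by `e_n(X) ~ (2 log n/(b-1))^{1/2} · e_n(U_X)`. -/
theorem quantization_entropy_relation
    {H : Type*} [NormedAddCommGroup H] [InnerProductSpace ℝ H] [CompleteSpace H]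
    [TopologicalSpace.SeparableSpace H]
    {Ω : Type*} [MeasurableSpace Ω] (P : Measure Ω) [IsProbabilityMeasure P]
    (X : Ω → H)
    (hXmeas : AEStronglyMeasurable X P)
    (hXint : Integrable (fun ω => ‖X ω‖ ^ 2) P)
    -- `X` is a centered Gaussian random vector
    (hGauss : ∀ y : H, ∃ v : ℝ≥0,
      Measure.map (fun ω => ⟪y, X ω⟫) P = gaussianReal 0 v)
    -- `lam` enumerates (in nonincreasing order, with multiplicity) the nonzero eigenvalues
    -- of the covariance operator `C_X y = E(⟪y,X⟫ X)`, with orthonormal eigenvectors `u`;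
    -- all `lam j > 0`, so the Cameron–Martin space is infinite dimensional
    (u : ℕ → H) (hu : Orthonormal ℝ u)
    (lam : ℕ → ℝ) (hlam_pos : ∀ j, 0 < lam j) (hlam_anti : Antitone lam)
    (heig : ∀ j, ∀ y : H, ∫ ω, ⟪u j, X ω⟫ * ⟪y, X ω⟫ ∂P = lam j * ⟪u j, y⟫)
    (hspan : ∀ᵐ ω ∂P, X ω ∈ closure (Submodule.span ℝ (Set.range u) : Set H))
    -- `φ : (s,∞) → (0,∞)` is decreasing and regularly varying at infinity of index `-b`
    (s b : ℝ) (hs : 0 ≤ s) (hb : 1 < b)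
    (φ : ℝ → ℝ) (hφ_pos : ∀ x, s < x → 0 < φ x)
    (hφ_dec : ∀ x y, s < x → x ≤ y → φ y ≤ φ x)
    (hφ_rv : ∀ c : ℝ, 0 < c →
      Tendsto (fun x : ℝ => φ (c * x) / φ x) atTop (nhds (c ^ (-b))))
    -- `λ_j ~ φ(j)` as `j → ∞`
    (hasymp : Tendsto (fun j : ℕ => lam j / φ j) atTop (nhds 1))
    -- `U_X` is the closed unit ball of the Cameron–Martin space
    (U : Set H)
    (hU : U = {x ∈ closure (Submodule.span ℝ (Set.range u) : Set H) |
        Summable (fun j => ⟪x, u j⟫ ^ 2 / lam j) ∧ ∑' j, ⟪x, u j⟫ ^ 2 / lam j ≤ 1}) :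
    Tendsto (fun n : ℕ =>
        quantErr P X n /
          ((2 * Real.log n / (b - 1)) ^ (1/2 : ℝ) * entropyNum U n))
      atTop (nhds 1) := by
  subst hU
  have hpot : HasPotterBounds b lam := fun ε hε hεb =>
    exists_abs_log_div_sub_mul_log_le hφ_pos hφ_dec hφ_rv hlam_pos hasymp hε hεb
  exact hpot.tendsto_quantErr_div_entropyNum hb hXmeas hXint hGauss hu hlam_pos hlam_anti heig hspan
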